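/- The R-module Hom_R(R/I, H^{m+n−2}_I(R)) is not finitely generated; that is, the local cohomology module H^{m+n−2}_I(R) is not I-cofinite and so I is not a cofinite ideal. -/

import Mathlib

open CategoryTheory Opposite MvPowerSeries

set_option synthInstance.maxHeartbeats 1000000
set_option maxHeartbeats 1000000

noncomputable section

/-- The grade of an ideal: the maximal length of a regular sequence contained in it. -/
def idealGrade {A : Type} [CommRing A] (J : Ideal A) : ℕ∞ :=
  sSup {c : ℕ∞ | ∃ rs : List A, (∀ r ∈ rs, r ∈ J) ∧
    RingTheory.Sequence.IsRegular A rs ∧ (rs.length : ℕ∞) = c}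

/-- The height of an ideal: the infimum of heights of primes containing it. -/
def idealHeight {A : Type} [CommRing A] (J : Ideal A) : ℕ∞ :=
  sInf {h : ℕ∞ | ∃ p : PrimeSpectrum A, J ≤ p.asIdeal ∧ Order.height p = h}

/-- A canonical module of a `d`-dimensional local ring `A`: a finitely generated module `ω`
with `Ext_A^i(𝕜, ω) = 0` for `i ≠ d` and `Ext_A^d(𝕜, ω)` a one-dimensional `𝕜`-vector space
(equivalently, isomorphic to `𝕜` as an `A`-module), where `𝕜` is the residue field. -/
def IsCanonicalModule (A : Type) [CommRing A] [IsLocalRing A] (d : ℕ)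
    (ω : ModuleCat A) : Prop :=
  Module.Finite A ω ∧
  (∀ i : ℕ, i ≠ d → Subsingleton
    (((Ext A (ModuleCat A) i).obj
      (op (ModuleCat.of A (IsLocalRing.ResidueField A)))).obj ω)) ∧
  Nonempty ((((Ext A (ModuleCat A) d).obj
      (op (ModuleCat.of A (IsLocalRing.ResidueField A)))).obj ω)
    ≃ₗ[A] IsLocalRing.ResidueField A)

variable (𝕜 : Type) [Field 𝕜] (m n : ℕ)

/-- The formal power series ring `P` in the entries of an `m × n` matrix of variables. -/
abbrev DetP := MvPowerSeries (Fin m × Fin n) 𝕜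

/-- The ideal of `P` generated by the `2 × 2` minors of the matrix of variables. -/
def detI2 : Ideal (DetP 𝕜 m n) :=
  Ideal.span {f | ∃ (i k : Fin m) (j l : Fin n), i < k ∧ j < l ∧
    f = X (i, j) * X (k, l) - X (i, l) * X (k, j)}

/-- The complete determinantal ring `R = P/I₂(X)`. -/
abbrev DetR := DetP 𝕜 m n ⧸ detI2 𝕜 m n

/-- The residue class in `R` of the variable `x_{ij}`. -/
def detx (i : Fin m) (j : Fin n) : DetR 𝕜 m n :=
  Ideal.Quotient.mk (detI2 𝕜 m n) (X (i, j))

/-- The ideal `I` of `R` generated by the entries of the first `n - 1` columns. -/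
def detJ : Ideal (DetR 𝕜 m n) :=
  Ideal.span {x | ∃ (i : Fin m) (j : Fin n), (j : ℕ) < n - 1 ∧ x = detx 𝕜 m n i j}

/-- The formal power series ring `S = 𝕜[[x_1, …, x_m, a_1, …, a_{n-1}]]`. -/
abbrev DetS := MvPowerSeries (Fin m ⊕ Fin (n - 1)) 𝕜

/-- The ideal `𝔞 = (a_1, …, a_{n-1})S`. -/
def detA : Ideal (DetS 𝕜 m n) :=
  Ideal.span {f | ∃ j : Fin (n - 1), f = X (Sum.inr j)}

/-- The property pinning down the local `𝕜`-algebra homomorphism `φ : R → S`: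
`x_{ij} ↦ a_j·x_i` for `1 ≤ j ≤ n-1` and `x_{in} ↦ x_i` (in `0`-based indexing, the last
column is `j = n-1`).  Any `𝕜`-algebra homomorphism `R → S` with these values on the
variables automatically maps the maximal ideal into the maximal ideal, hence is continuous
and is uniquely determined by these values; so this predicate characterizes `φ`. -/
def IsDetPhi (φ : DetR 𝕜 m n →ₐ[𝕜] DetS 𝕜 m n) : Prop :=
  ∀ (i : Fin m) (j : Fin n),
    φ (detx 𝕜 m n i j) =
      if h : (j : ℕ) < n - 1 then X (Sum.inr (⟨j, h⟩ : Fin (n - 1))) * X (Sum.inl i)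
      else X (Sum.inl i)

namespace TorsionExt

variable {A : Type} [CommRing A] (J : Ideal A)

/-- The transition map `A ⧸ J ^ t ⟶ A ⧸ J ^ s` for `s ≤ t`. -/
def quotPowMap {s t : ℕ} (h : s ≤ t) :
    ModuleCat.of A (A ⧸ J ^ t) ⟶ ModuleCat.of A (A ⧸ J ^ s) :=
  ModuleCat.ofHom (Submodule.mapQ _ _ LinearMap.id (Ideal.pow_le_pow_right h))

lemma quotPowMap_refl (s : ℕ) : quotPowMap J (le_refl s) = 𝟙 _ := by
  refine ModuleCat.hom_ext (LinearMap.ext fun x => ?_)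
  obtain ⟨x, rfl⟩ := Submodule.Quotient.mk_surjective _ x
  rfl

lemma quotPowMap_comp {s t u : ℕ} (h : s ≤ t) (h' : t ≤ u) :
    quotPowMap J h' ≫ quotPowMap J h = quotPowMap J (h.trans h') := by
  refine ModuleCat.hom_ext (LinearMap.ext fun x => ?_)
  obtain ⟨x, rfl⟩ := Submodule.Quotient.mk_surjective _ x
  rfl

/-- The transition map of the system `Ext^i(A ⧸ J ^ t, M)`. -/
def extTrans (i : ℕ) (M : ModuleCat A) (s t : ℕ) (h : s ≤ t) :
    Abelian.Ext (ModuleCat.of A (A ⧸ J ^ s)) M i →ₗ[A]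
      Abelian.Ext (ModuleCat.of A (A ⧸ J ^ t)) M i :=
  (Abelian.Ext.mk₀ (quotPowMap J h)).precompOfLinear A M (zero_add i)

lemma extTrans_apply (i : ℕ) (M : ModuleCat A) {s t : ℕ} (h : s ≤ t)
    (x : Abelian.Ext (ModuleCat.of A (A ⧸ J ^ s)) M i) :
    extTrans J i M s t h x = (Abelian.Ext.mk₀ (quotPowMap J h)).comp x (zero_add i) := rfl

instance (i : ℕ) (M : ModuleCat A) : DirectedSystem
    (fun t : ℕ => Abelian.Ext (ModuleCat.of A (A ⧸ J ^ t)) M i)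
    (fun s t h => extTrans J i M s t h) where
  map_self s x := by
    rw [extTrans_apply, quotPowMap_refl, Abelian.Ext.mk₀_id_comp]
  map_map s t u h h' x := by
    rw [extTrans_apply, extTrans_apply, extTrans_apply, Abelian.Ext.mk₀_comp_mk₀_assoc,
      quotPowMap_comp]

/-- The direct limit of `Ext^i(A ⧸ J ^ t, M)`, computed with the `Ext` groups of the derived
category. -/
abbrev T (i : ℕ) (M : ModuleCat A) : Type :=
  Module.DirectLimit (fun t : ℕ => Abelian.Ext (ModuleCat.of A (A ⧸ J ^ t)) M i)
    (extTrans J i M)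

/-- The structure map to the direct limit. -/
abbrev ofExt (i : ℕ) (M : ModuleCat A) (t : ℕ) :
    Abelian.Ext (ModuleCat.of A (A ⧸ J ^ t)) M i →ₗ[A] T J i M :=
  Module.DirectLimit.of A ℕ _ (extTrans J i M) t

/-- Functoriality of `T`. -/
def map (i : ℕ) {M N : ModuleCat A} (f : M ⟶ N) : T J i M →ₗ[A] T J i N :=
  Module.DirectLimit.map
    (fun t => (Abelian.Ext.mk₀ f).postcompOfLinear A _ (add_zero i)) (fun s t h => by
      refine LinearMap.ext fun x => ?_
      exact Abelian.Ext.comp_assoc _ _ _ (zero_add _) rfl (by lia))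

lemma map_of (i : ℕ) {M N : ModuleCat A} (f : M ⟶ N) (t : ℕ)
    (x : Abelian.Ext (ModuleCat.of A (A ⧸ J ^ t)) M i) :
    map J i f (ofExt J i M t x) = ofExt J i N t (x.comp (Abelian.Ext.mk₀ f) (add_zero i)) :=
  Module.DirectLimit.map_apply_of _ _ _

lemma map_comp (i : ℕ) {M N K : ModuleCat A} (f : M ⟶ N) (g : N ⟶ K) (x : T J i M) :
    map J i (f ≫ g) x = map J i g (map J i f x) := by
  obtain ⟨t, x, rfl⟩ := Module.DirectLimit.exists_of x
  rw [map_of, map_of, map_of, Abelian.Ext.comp_assoc_of_second_deg_zero,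
    Abelian.Ext.mk₀_comp_mk₀]

lemma map_id' (i : ℕ) {M : ModuleCat A} (x : T J i M) : map J i (𝟙 M) x = x := by
  obtain ⟨t, x, rfl⟩ := Module.DirectLimit.exists_of x
  rw [map_of, Abelian.Ext.comp_mk₀_id]

section ShortExact

variable {S : ShortComplex (ModuleCat A)} (hS : S.ShortExact)

/-- The connecting map of `T`. -/
def δ (i : ℕ) : T J i S.X₃ →ₗ[A] T J (i + 1) S.X₁ :=
  Module.DirectLimit.map
    (fun t => hS.extClass.postcompOfLinear A _ rfl) (fun s t h => by
      refine LinearMap.ext fun x => ?_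
      exact Abelian.Ext.comp_assoc _ _ _ (zero_add _) rfl (by lia))

lemma δ_of (i t : ℕ) (x : Abelian.Ext (ModuleCat.of A (A ⧸ J ^ t)) S.X₃ i) :
    δ J hS i (ofExt J i S.X₃ t x) = ofExt J (i + 1) S.X₁ t (x.comp hS.extClass rfl) :=
  Module.DirectLimit.map_apply_of _ _ _

lemma exists_of_ofExt_eq_zero {i : ℕ} {M : ModuleCat A} {t : ℕ}
    {x : Abelian.Ext (ModuleCat.of A (A ⧸ J ^ t)) M i} (hx : ofExt J i M t x = 0) :
    ∃ u, ∃ h : t ≤ u, (Abelian.Ext.mk₀ (quotPowMap J h)).comp x (zero_add i) = 0 :=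
  Module.DirectLimit.of.zero_exact hx

lemma ofExt_trans {i : ℕ} {M : ModuleCat A} {t u : ℕ} (h : t ≤ u)
    (x : Abelian.Ext (ModuleCat.of A (A ⧸ J ^ t)) M i) :
    ofExt J i M u ((Abelian.Ext.mk₀ (quotPowMap J h)).comp x (zero_add i)) =
      ofExt J i M t x :=
  Module.DirectLimit.of_f (f := extTrans J i M) (hij := h)

lemma exact₁ {i : ℕ} (x : T J (i + 1) S.X₁) (hx : map J (i + 1) S.f x = 0) :
    ∃ y, δ J hS i y = x := by
  obtain ⟨t, x, rfl⟩ := Module.DirectLimit.exists_of x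
  rw [map_of] at hx
  obtain ⟨u, h, hx⟩ := exists_of_ofExt_eq_zero J hx
  rw [← Abelian.Ext.comp_assoc _ _ _ (zero_add _) _ (by lia)] at hx
  obtain ⟨y, hy⟩ := Abelian.Ext.covariant_sequence_exact₁ _ hS _ hx rfl
  exact ⟨ofExt J i _ u y, by rw [δ_of, hy, ofExt_trans]⟩

lemma exact₂ (hS : S.ShortExact) {i : ℕ} (x : T J i S.X₂) (hx : map J i S.g x = 0) :
    ∃ y, map J i S.f y = x := by
  obtain ⟨t, x, rfl⟩ := Module.DirectLimit.exists_of x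
  rw [map_of] at hx
  obtain ⟨u, h, hx⟩ := exists_of_ofExt_eq_zero J hx
  rw [← Abelian.Ext.comp_assoc _ _ _ (zero_add _) _ (by lia)] at hx
  obtain ⟨y, hy⟩ := Abelian.Ext.covariant_sequence_exact₂ _ hS _ hx
  exact ⟨ofExt J i _ u y, by rw [map_of, hy, ofExt_trans]⟩

lemma exact₃ {i : ℕ} (x : T J i S.X₃) (hx : δ J hS i x = 0) :
    ∃ y, map J i S.g y = x := by
  obtain ⟨t, x, rfl⟩ := Module.DirectLimit.exists_of x
  rw [δ_of] at hx
  obtain ⟨u, h, hx⟩ := exists_of_ofExt_eq_zero J hx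
  rw [← Abelian.Ext.comp_assoc _ _ _ (zero_add _) _ (by lia)] at hx
  obtain ⟨y, hy⟩ := Abelian.Ext.covariant_sequence_exact₃ _ hS _ rfl hx
  exact ⟨ofExt J i _ u y, by rw [map_of, hy, ofExt_trans]⟩

lemma δ_map {i : ℕ} (x : T J i S.X₂) : δ J hS i (map J i S.g x) = 0 := by
  obtain ⟨t, x, rfl⟩ := Module.DirectLimit.exists_of x
  rw [map_of, δ_of, Abelian.Ext.comp_assoc _ _ _ _ (zero_add 1) (by lia), hS.comp_extClass,
    Abelian.Ext.comp_zero, map_zero]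

lemma δ_naturality {S' : ShortComplex (ModuleCat A)} (hS' : S'.ShortExact) (f : S ⟶ S')
    {i : ℕ} (x : T J i S.X₃) :
    map J (i + 1) f.τ₁ (δ J hS i x) = δ J hS' i (map J i f.τ₃ x) := by
  obtain ⟨t, x, rfl⟩ := Module.DirectLimit.exists_of x
  rw [map_of, δ_of, δ_of, map_of, Abelian.Ext.comp_assoc _ _ _ _ (add_zero 1) (by lia),
    ShortComplex.ShortExact.extClass_naturality hS hS' f,
    Abelian.Ext.comp_assoc _ _ _ _ (zero_add 1) (by lia)]

lemma δ_injective (i : ℕ) (h : Subsingleton (T J i S.X₂)) :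
    Function.Injective (δ J hS i) := by
  rw [injective_iff_map_eq_zero]
  intro x hx
  obtain ⟨y, rfl⟩ := exact₃ J hS x hx
  rw [Subsingleton.elim y 0, map_zero]

lemma δ_surjective (i : ℕ) (h : Subsingleton (T J (i + 1) S.X₂)) :
    Function.Surjective (δ J hS i) :=
  fun x => exact₁ J hS x (Subsingleton.elim _ _)

end ShortExact

lemma subsingleton_of_bijective_smul {M : ModuleCat A} {g : A} (hg : g ∈ J)
    (hb : Function.Bijective fun x : M => g • x) (i : ℕ) : Subsingleton (T J i M) := by
  refine subsingleton_of_forall_eq 0 fun x => ?_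
  obtain ⟨t, x, rfl⟩ := Module.DirectLimit.exists_of x
  have hbt : Function.Bijective fun x : M => g ^ t • x := by
    have h : (fun x : M => g ^ t • x) = (fun x : M => g • x)^[t] := by
      funext x
      exact (smul_iterate_apply g t x).symm
    rw [h]
    exact hb.iterate t
  have : IsIso (g ^ t • 𝟙 M) := by
    exact (ConcreteCategory.isIso_iff_bijective (g ^ t • 𝟙 M)).mpr hbt
  have h1 : g ^ t • 𝟙 (ModuleCat.of A (A ⧸ J ^ t)) = 0 := by
    refine ModuleCat.hom_ext (LinearMap.ext fun y => ?_)
    obtain ⟨y, rfl⟩ := Submodule.Quotient.mk_surjective _ y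
    change g ^ t • (Submodule.Quotient.mk y : A ⧸ J ^ t) = 0
    rw [← Submodule.Quotient.mk_smul, Submodule.Quotient.mk_eq_zero]
    exact Ideal.mul_mem_right _ _ (Ideal.pow_mem_pow hg t)
  have h2 : g ^ t • x = 0 := by
    conv_lhs => rw [← Abelian.Ext.mk₀_id_comp x]
    rw [← Abelian.Ext.smul_comp, ← Abelian.Ext.mk₀_smul, h1, Abelian.Ext.mk₀_zero,
      Abelian.Ext.zero_comp]
  rw [Abelian.Ext.smul_eq_comp_mk₀] at h2
  have h3 : x = 0 := by
    rw [← Abelian.Ext.comp_mk₀_id x, ← IsIso.hom_inv_id (g ^ t • 𝟙 M),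
      ← Abelian.Ext.mk₀_comp_mk₀, ← Abelian.Ext.comp_assoc _ _ _ (add_zero i) _ (by lia), h2,
      Abelian.Ext.zero_comp]
  rw [h3, map_zero]

/-- Evaluation at `1` of an element of `Ext^0(A ⧸ J ^ t, M)`. -/
def evAt (M : ModuleCat A) (t : ℕ) : Abelian.Ext (ModuleCat.of A (A ⧸ J ^ t)) M 0 →ₗ[A] M where
  toFun x := (Abelian.Ext.linearEquiv₀ (R := A) x).hom (Submodule.Quotient.mk 1 : A ⧸ J ^ t)
  map_add' x y := by
    rw [map_add]
    rfl
  map_smul' r x := by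
    rw [map_smul]
    rfl

lemma evAt_mk₀ {M : ModuleCat A} (t : ℕ) (f : ModuleCat.of A (A ⧸ J ^ t) ⟶ M) :
    evAt J M t (Abelian.Ext.mk₀ f) = f (Submodule.Quotient.mk 1 : A ⧸ J ^ t) := by
  rw [← Abelian.Ext.linearEquiv₀_symm_apply (R := A)]
  exact congrArg (fun h : ModuleCat.of A (A ⧸ J ^ t) ⟶ M =>
    h.hom (Submodule.Quotient.mk 1 : A ⧸ J ^ t)) (LinearEquiv.apply_symm_apply _ f)

/-- Evaluation at `1`, from the direct limit of `Hom(A ⧸ J ^ t, M)` to `M`. -/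
def ev (M : ModuleCat A) : T J 0 M →ₗ[A] M :=
  Module.DirectLimit.lift A ℕ _ _ (evAt J M) (fun s t h x => by
    obtain ⟨f, rfl⟩ := Abelian.Ext.homEquiv₀.symm.surjective x
    change evAt J M t (_) = evAt J M s (Abelian.Ext.mk₀ f)
    rw [extTrans_apply]
    refine (congrArg _ (Abelian.Ext.mk₀_comp_mk₀ _ f)).trans ?_
    rw [evAt_mk₀, evAt_mk₀]
    rfl)

lemma ev_of_mk₀ {M : ModuleCat A} (t : ℕ) (f : ModuleCat.of A (A ⧸ J ^ t) ⟶ M) :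
    ev J M (ofExt J 0 M t (Abelian.Ext.mk₀ f)) = f (Submodule.Quotient.mk 1 : A ⧸ J ^ t) :=
  (Module.DirectLimit.lift_of _ _ _).trans (evAt_mk₀ J t f)

lemma exists_ofExt_mk₀ {M : ModuleCat A} (x : T J 0 M) :
    ∃ t, ∃ f : ModuleCat.of A (A ⧸ J ^ t) ⟶ M, ofExt J 0 M t (Abelian.Ext.mk₀ f) = x := by
  obtain ⟨t, x, rfl⟩ := Module.DirectLimit.exists_of x
  obtain ⟨f, rfl⟩ := Abelian.Ext.homEquiv₀.symm.surjective x
  exact ⟨t, f, rfl⟩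

lemma ev_map {M N : ModuleCat A} (f : M ⟶ N) (x : T J 0 M) :
    ev J N (map J 0 f x) = f (ev J M x) := by
  obtain ⟨t, g, rfl⟩ := exists_ofExt_mk₀ J x
  rw [map_of, Abelian.Ext.mk₀_comp_mk₀, ev_of_mk₀, ev_of_mk₀]
  rfl

lemma ev_injective (M : ModuleCat A) : Function.Injective (ev J M) := by
  rw [injective_iff_map_eq_zero]
  intro x hx
  obtain ⟨t, g, rfl⟩ := exists_ofExt_mk₀ J x
  rw [ev_of_mk₀] at hx
  have : g = 0 := by
    refine ModuleCat.hom_ext (LinearMap.ext fun y => ?_)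
    obtain ⟨y, rfl⟩ := Submodule.Quotient.mk_surjective _ y
    have h1 : (Submodule.Quotient.mk y : A ⧸ J ^ t) = y • Submodule.Quotient.mk 1 := by
      rw [← Submodule.Quotient.mk_smul, smul_eq_mul, mul_one]
    rw [h1, map_smul, map_smul]
    exact congrArg (y • ·) hx
  rw [this, Abelian.Ext.mk₀_zero, map_zero]

/-- Every element of `M` is killed by a power of `J`. -/
def IsTors (M : Type) [AddCommGroup M] [Module A M] : Prop :=
  ∀ x : M, ∃ t, ∀ a ∈ J ^ t, a • x = 0

variable {J} in
lemma IsTors.ev_surjective {M : ModuleCat A} (hM : IsTors J M) : Function.Surjective (ev J M) := by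
  intro x
  obtain ⟨t, ht⟩ := hM x
  let f : (A ⧸ J ^ t) →ₗ[A] M :=
    (J ^ t).liftQ (LinearMap.toSpanSingleton A M x) fun a ha => ht a ha
  refine ⟨ofExt J 0 M t (Abelian.Ext.mk₀ (ModuleCat.ofHom f)), ?_⟩
  rw [ev_of_mk₀]
  exact one_smul A x

/-- The `J`-power torsion submodule. -/
def torsPart (E : Type) [AddCommGroup E] [Module A E] : Submodule A E where
  carrier := {x | ∃ t, ∀ a ∈ J ^ t, a • x = 0}
  zero_mem' := ⟨0, fun a _ => smul_zero a⟩
  add_mem' := by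
    rintro x y ⟨s, hs⟩ ⟨t, ht⟩
    refine ⟨s + t, fun a ha => ?_⟩
    rw [smul_add, hs a (Ideal.pow_le_pow_right (by lia) ha),
      ht a (Ideal.pow_le_pow_right (by lia) ha), add_zero]
  smul_mem' := by
    rintro r x ⟨t, ht⟩
    exact ⟨t, fun a ha => by rw [smul_comm, ht a ha, smul_zero]⟩

lemma isTors_torsPart (E : Type) [AddCommGroup E] [Module A E] : IsTors J (torsPart J E) := by
  rintro ⟨x, t, ht⟩
  exact ⟨t, fun a ha => Subtype.ext (ht a ha)⟩

variable {J} in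
lemma IsTors.exists_uniform {I : Ideal A} (hI : I.FG) {M : Type} [AddCommGroup M] [Module A M]
    (hM : IsTors J M) (g : I →ₗ[A] M) : ∃ k, ∀ a ∈ J ^ k, ∀ x, a • g x = 0 := by
  have : Module.Finite A I := Module.Finite.iff_fg.mpr hI
  obtain ⟨s, hs⟩ := this.fg_top
  choose k hk using hM
  refine ⟨s.sup fun x => k (g x), fun a ha x => ?_⟩
  have hx : x ∈ Submodule.span A (s : Set I) := hs ▸ Submodule.mem_top
  induction hx using Submodule.span_induction with
  | mem x hx =>
    exact hk _ a (Ideal.pow_le_pow_right (Finset.le_sup (f := fun x => k (g x)) hx) ha)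
  | zero => rw [map_zero, smul_zero]
  | add x y _ _ hx hy => rw [map_add, smul_add, hx, hy, add_zero]
  | smul r x _ hx => rw [map_smul, smul_comm, hx, smul_zero]

lemma injective_torsPart [IsNoetherianRing A] (E : Type) [AddCommGroup E] [Module A E]
    (hE : Module.Baer A E) : Module.Injective A (torsPart J E) := by
  refine Module.Baer.injective fun I g => ?_
  obtain ⟨k, hk⟩ := (isTors_torsPart J E).exists_uniform (IsNoetherian.noetherian I) g
  obtain ⟨k', hk'⟩ := J.exists_pow_inf_eq_pow_smul (M := A) I
  have hkill : ∀ (x : A) (hx : x ∈ I), x ∈ J ^ (k + k') → g ⟨x, hx⟩ = 0 := by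
    intro x hx hxJ
    have h1 : x ∈ J ^ (k + k' - k') • (J ^ k' • (⊤ : Submodule A A) ⊓ I) := by
      rw [← hk' (k + k') (by lia)]
      refine ⟨?_, hx⟩
      have := Submodule.smul_mem_smul hxJ (Submodule.mem_top : (1 : A) ∈ (⊤ : Submodule A A))
      rwa [show x • (1 : A) = x from mul_one x] at this
    have h2 : x ∈ J ^ k • (I : Submodule A A) := by
      rw [Nat.add_sub_cancel] at h1
      exact Submodule.smul_mono le_rfl inf_le_right h1
    have h3 : J ^ k • (I : Submodule A A) ≤ Submodule.map I.subtype (LinearMap.ker g) := by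
      rw [Submodule.smul_le]
      intro a ha y hy
      exact ⟨a • ⟨y, hy⟩, by rw [SetLike.mem_coe, LinearMap.mem_ker, map_smul, hk a ha], rfl⟩
    obtain ⟨y, hy, rfl⟩ := h3 h2
    exact hy
  let p : A →ₗ.[A] E := ⟨I, (torsPart J E).subtype.comp g⟩
  let q : A →ₗ.[A] E := ⟨J ^ (k + k'), 0⟩
  have hpq : ∀ (x : p.domain) (y : q.domain), (x : A) = y → p x = q y := by
    rintro ⟨x, hx⟩ ⟨y, hy⟩ h
    obtain rfl : x = y := h
    change ((g ⟨x, hx⟩ : torsPart J E) : E) = 0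
    rw [hkill x hx hy]
    rfl
  obtain ⟨h, hh⟩ := hE (p.sup q hpq).domain (p.sup q hpq).toFun
  have hI : ∀ (x : A) (hx : x ∈ I), h x = g ⟨x, hx⟩ := by
    intro x hx
    have hle := p.left_le_sup q hpq
    rw [hh x (hle.1 hx)]
    exact (hle.2 (x := ⟨x, hx⟩) (y := ⟨x, hle.1 hx⟩) rfl).symm
  have hJ : ∀ a ∈ J ^ (k + k'), h a = 0 := by
    intro x hx
    have hle := p.right_le_sup q hpq
    rw [hh x (hle.1 hx)]
    exact (hle.2 (x := ⟨x, hx⟩) (y := ⟨x, hle.1 hx⟩) rfl).symm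
  have hmem : ∀ x, h x ∈ torsPart J E := by
    intro x
    refine ⟨k + k', fun a ha => ?_⟩
    rw [← map_smul]
    exact hJ _ (Ideal.mul_mem_right _ _ ha)
  exact ⟨h.codRestrict _ hmem, fun x hx => Subtype.ext (hI x hx)⟩

lemma subsingleton_of_injective (M : ModuleCat A) [Injective M] (i : ℕ) :
    Subsingleton (T J (i + 1) M) := by
  refine subsingleton_of_forall_eq 0 fun x => ?_
  obtain ⟨t, x, rfl⟩ := Module.DirectLimit.exists_of x
  rw [Abelian.Ext.eq_zero_of_injective x, map_zero]

variable {J} in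
lemma IsTors.exists_shortExact [IsNoetherianRing A] {M : ModuleCat A} (hM : IsTors J M) :
    ∃ (X Q : ModuleCat A) (f : M ⟶ X) (g : X ⟶ Q) (w : f ≫ g = 0),
      (ShortComplex.mk f g w).ShortExact ∧ Injective X ∧ IsTors J X ∧ IsTors J Q := by
  let E := Injective.under M
  have : Injective (ModuleCat.of A E) := inferInstanceAs (Injective (Injective.under M))
  have hE : Module.Injective A E := Module.injective_module_of_injective_object A E
  have : Module.Injective A (torsPart J E) := injective_torsPart J E (.of_injective hE)
  let f : M →ₗ[A] torsPart J E := (Injective.ι M).hom.codRestrict _ fun x => by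
    obtain ⟨t, ht⟩ := hM x
    exact ⟨t, fun a ha => by rw [← map_smul, ht a ha, map_zero]⟩
  have hf : Function.Injective f := by
    intro x y h
    exact (ModuleCat.mono_iff_injective (Injective.ι M)).mp inferInstance
      (congrArg Subtype.val h)
  refine ⟨ModuleCat.of A (torsPart J E), ModuleCat.of A (torsPart J E ⧸ LinearMap.range f),
    ModuleCat.ofHom f, ModuleCat.ofHom (LinearMap.range f).mkQ, ?_, ?_,
    Module.injective_object_of_injective_module A _, isTors_torsPart J E, ?_⟩
  · exact ModuleCat.hom_ext (LinearMap.range_mkQ_comp f)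
  · exact ModuleCat.shortComplex_shortExact _ (LinearMap.exact_iff.mpr (by
      exact Submodule.ker_mkQ _)) hf (Submodule.mkQ_surjective _)
  · intro x
    obtain ⟨x, rfl⟩ := Submodule.Quotient.mk_surjective _ x
    obtain ⟨t, ht⟩ := isTors_torsPart J E x
    exact ⟨t, fun a ha => by rw [← Submodule.Quotient.mk_smul, ht a ha]; rfl⟩

variable {J} in
lemma IsTors.subsingleton [IsNoetherianRing A] (i : ℕ) :
    ∀ {M : ModuleCat A}, IsTors J M → Subsingleton (T J (i + 1) M) := by
  induction i with
  | zero =>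
    intro M hM
    obtain ⟨X, Q, f, g, w, hS, hinj, hX, hQ⟩ := hM.exists_shortExact
    refine subsingleton_of_forall_eq 0 fun x => ?_
    obtain ⟨y, rfl⟩ := δ_surjective J hS 0 (subsingleton_of_injective J X 0) x
    obtain ⟨z, hz⟩ := hS.moduleCat_surjective_g (ev J Q y)
    obtain ⟨z, rfl⟩ := hX.ev_surjective z
    have : y = map J 0 g z := ev_injective J Q (by rw [ev_map]; exact hz.symm)
    rw [this]
    exact δ_map J hS z
  | succ i ih =>
    intro M hM
    obtain ⟨X, Q, f, g, w, hS, hinj, hX, hQ⟩ := hM.exists_shortExact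
    have := ih hQ
    exact (δ_surjective J hS (i + 1) (subsingleton_of_injective J X (i + 1))).subsingleton

end TorsionExt

namespace TorsionExt

section OldExt

variable {A : Type} [CommRing A]

section Complex

variable (K : ChainComplex (ModuleCat.{0} A)ᵒᵖ ℕ) (n : ℕ)

/-- The cocycles of the opposite of a complex. -/
abbrev cocyc : ModuleCat.{0} A := unop (K.opcycles n)

/-- The inclusion of the cocycles. -/
def cocycι : cocyc K n →ₗ[A] (unop (K.X n) : ModuleCat.{0} A) := (K.pOpcycles n).unop.hom

/-- The projection from cocycles to cohomology. -/
def cocycπ : cocyc K n →ₗ[A] (unop (K.homology n) : ModuleCat.{0} A) := (K.homologyι n).unop.hom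

lemma cocycι_injective : Function.Injective (cocycι K n) :=
  (ModuleCat.mono_iff_injective (K.pOpcycles n).unop).mp inferInstance

lemma exists_cocycι (f : (unop (K.X n) : ModuleCat.{0} A)) (hf : (K.d (n + 1) n).unop f = 0) :
    ∃ z, cocycι K n z = f := by
  let k : K.X n ⟶ op (ModuleCat.of A A) :=
    (ModuleCat.ofHom (LinearMap.toSpanSingleton A _ f)).op
  have hk : K.d (n + 1) n ≫ k = 0 := by
    apply Quiver.Hom.unop_inj
    refine ModuleCat.hom_ext (LinearMap.ext_ring ?_)
    change (K.d (n + 1) n).unop ((1 : A) • f) = 0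
    rw [one_smul, hf]
  refine ⟨(K.descOpcycles k (n + 1) (by simp) hk).unop (1 : A), ?_⟩
  have := congrArg (fun g : K.X n ⟶ op (ModuleCat.of A A) => g.unop (1 : A))
    (K.p_descOpcycles k (n + 1) (by simp) hk)
  exact this.trans (one_smul A f)

lemma cocycπ_eq_zero_iff (z : cocyc K (n + 1)) :
    cocycπ K (n + 1) z = 0 ↔ ∃ g, (K.d (n + 1) n).unop g = cocycι K (n + 1) z := by
  have hex : (ShortComplex.mk (K.homologyι (n + 1)) (K.fromOpcycles (n + 1) n)
      (K.homologyι_comp_fromOpcycles (n + 1) n)).Exact := by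
    exact ShortComplex.exact_of_f_is_kernel _ (K.homologyIsKernel (n + 1) n (by simp))
  have hex' := (ShortComplex.moduleCat_exact_iff _).mp hex.unop
  have hd : ∀ g, (K.d (n + 1) n).unop g =
      cocycι K (n + 1) ((K.fromOpcycles (n + 1) n).unop g) := by
    intro g
    rw [← K.p_fromOpcycles (n + 1) n]
    rfl
  constructor
  · intro h
    obtain ⟨g, hg⟩ := hex' z h
    exact ⟨g, (hd g).trans (congrArg _ hg)⟩
  · rintro ⟨g, hg⟩
    rw [hd] at hg
    rw [← cocycι_injective K (n + 1) hg]
    have := K.homologyι_comp_fromOpcycles (n + 1) n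
    exact congrArg (fun φ : K.homology (n + 1) ⟶ K.X n => φ.unop g) this

variable {K n} in
lemma cocyc_map {K' : ChainComplex (ModuleCat.{0} A)ᵒᵖ ℕ} (φ : K ⟶ K') (z : cocyc K' n) :
    cocycι K n ((HomologicalComplex.opcyclesMap φ n).unop z) = (φ.f n).unop (cocycι K' n z) ∧
    cocycπ K n ((HomologicalComplex.opcyclesMap φ n).unop z) =
      (HomologicalComplex.homologyMap φ n).unop (cocycπ K' n z) :=
  ⟨congrArg (fun g : K.X n ⟶ K'.opcycles n => g.unop z)
    (HomologicalComplex.p_opcyclesMap φ n),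
    (congrArg (fun g : K.homology n ⟶ K'.opcycles n => g.unop z)
      (HomologicalComplex.homologyι_naturality φ n)).symm⟩

end Complex

section Comparison

variable {X : ModuleCat.{0} A} (P : ProjectiveResolution X) (Y : ModuleCat.{0} A) (n : ℕ)

/-- The functor whose left derived functors compute `Ext`. -/
abbrev yonedaOp : ModuleCat.{0} A ⥤ (ModuleCat.{0} A)ᵒᵖ :=
  ((linearYoneda A (ModuleCat.{0} A)).obj Y).rightOp

/-- The complex computing `Ext(X, Y)` from a projective resolution of `X`. -/
abbrev homComplex : ChainComplex (ModuleCat.{0} A)ᵒᵖ ℕ :=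
  ((yonedaOp Y).mapHomologicalComplex _).obj P.complex

/-- The cocycle seen as a morphism. -/
def cocycHom (z : cocyc (homComplex P Y) n) : P.complex.X n ⟶ Y := cocycι _ n z

lemma d_cocycHom (z : cocyc (homComplex P Y) n) :
    P.complex.d (n + 1) n ≫ cocycHom P Y n z = 0 := by
  have h : (homComplex P Y).d (n + 1) n ≫ (homComplex P Y).pOpcycles n = 0 :=
    (homComplex P Y).d_pOpcycles (n + 1) n
  exact congrArg (fun φ : (homComplex P Y).X (n + 1) ⟶ (homComplex P Y).opcycles n => φ.unop z) h

/-- The class of a cocycle in the `Ext` group of the derived category. -/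
def newClass : cocyc (homComplex P Y) n →ₗ[A] Abelian.Ext X Y n where
  toFun z := P.extMk (cocycHom P Y n z) (n + 1) rfl (d_cocycHom P Y n z)
  map_add' z w := by
    rw [P.add_extMk]
    congr 1
    exact map_add (cocycι _ n) z w
  map_smul' r z := by
    rw [RingHom.id_apply, Abelian.Ext.smul_eq_comp_mk₀, P.extMk_comp_mk₀]
    congr 1
    exact (map_smul (cocycι _ n) r z).trans (by
      change r • cocycHom P Y n z = _
      rw [Linear.comp_smul, Category.comp_id])

/-- The class of a cocycle in the `Ext` module defined through left derived functors. -/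
def oldClass : cocyc (homComplex P Y) n →ₗ[A]
    (((Ext A (ModuleCat.{0} A) n).obj (op X)).obj Y : ModuleCat.{0} A) :=
  (P.isoLeftDerivedObj (yonedaOp Y) n).hom.unop.hom ∘ₗ cocycπ _ n

lemma newClass_surjective : Function.Surjective (newClass P Y n) := by
  intro x
  obtain ⟨f, hf, rfl⟩ := P.extMk_surjective x (n + 1) rfl
  obtain ⟨z, hz⟩ := exists_cocycι (homComplex P Y) n f hf
  refine ⟨z, ?_⟩
  change P.extMk (cocycHom P Y n z) (n + 1) rfl (d_cocycHom P Y n z) = _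
  congr 1

lemma ker_newClass : LinearMap.ker (newClass P Y (n + 1)) =
    LinearMap.ker (oldClass P Y (n + 1)) := by
  ext z
  rw [LinearMap.mem_ker, LinearMap.mem_ker]
  have h1 : newClass P Y (n + 1) z = 0 ↔ cocycπ (homComplex P Y) (n + 1) z = 0 :=
    (P.extMk_eq_zero_iff _ _ rfl (d_cocycHom P Y (n + 1) z) n rfl).trans
      (cocycπ_eq_zero_iff (homComplex P Y) n z).symm
  rw [h1]
  have hinj : Function.Injective (P.isoLeftDerivedObj (yonedaOp Y) (n + 1)).hom.unop :=
    (ModuleCat.mono_iff_injective _).mp inferInstance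
  exact (map_eq_zero_iff (P.isoLeftDerivedObj (yonedaOp Y) (n + 1)).hom.unop.hom hinj).symm

/-- The comparison map between the two definitions of `Ext`. -/
def compare : Abelian.Ext X Y (n + 1) →ₗ[A]
    (((Ext A (ModuleCat.{0} A) (n + 1)).obj (op X)).obj Y : ModuleCat.{0} A) :=
  (LinearMap.ker (newClass P Y (n + 1))).liftQ (oldClass P Y (n + 1)) (ker_newClass P Y n).le ∘ₗ
    ((newClass P Y (n + 1)).quotKerEquivOfSurjective
      (newClass_surjective P Y (n + 1))).symm.toLinearMap

lemma compare_newClass (z : cocyc (homComplex P Y) (n + 1)) :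
    compare P Y n (newClass P Y (n + 1) z) = oldClass P Y (n + 1) z := by
  have : ((newClass P Y (n + 1)).quotKerEquivOfSurjective
      (newClass_surjective P Y (n + 1))).symm (newClass P Y (n + 1) z) =
      Submodule.Quotient.mk z := by
    rw [LinearEquiv.symm_apply_eq]
    rfl
  exact (congrArg ((LinearMap.ker (newClass P Y (n + 1))).liftQ (oldClass P Y (n + 1))
    (ker_newClass P Y n).le) this).trans rfl

lemma compare_injective : Function.Injective (compare P Y n) := by
  rw [injective_iff_map_eq_zero]
  intro x hx
  obtain ⟨z, rfl⟩ := newClass_surjective P Y (n + 1) x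
  rw [compare_newClass] at hx
  change z ∈ LinearMap.ker (newClass P Y (n + 1))
  rw [ker_newClass]
  exact hx

variable {P Y n} in
lemma compare_naturality {X' : ModuleCat.{0} A} (P' : ProjectiveResolution X') (f : X ⟶ X')
    (x : Abelian.Ext X' Y (n + 1)) :
    compare P Y n ((Abelian.Ext.mk₀ f).comp x (zero_add (n + 1))) =
      ((Ext A (ModuleCat.{0} A) (n + 1)).map f.op).app Y (compare P' Y n x) := by
  obtain ⟨z, rfl⟩ := newClass_surjective P' Y (n + 1) x
  let φ : ProjectiveResolution.Hom P P' f :=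
    { hom := ProjectiveResolution.lift f P P'
      hom_f_zero_comp_π_f_zero := by
        rw [← HomologicalComplex.comp_f, ProjectiveResolution.lift_commutes]
        rfl }
  have hz := cocyc_map (((yonedaOp Y).mapHomologicalComplex _).map φ.hom) z
  have h1 : (Abelian.Ext.mk₀ f).comp (newClass P' Y (n + 1) z) (zero_add (n + 1)) =
      newClass P Y (n + 1) ((HomologicalComplex.opcyclesMap
        (((yonedaOp Y).mapHomologicalComplex _).map φ.hom) (n + 1)).unop z) := by
    refine (P'.mk₀_comp_extMk _ _ rfl (d_cocycHom P' Y (n + 1) z) φ).trans ?_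
    change _ = P.extMk (cocycHom P Y (n + 1) _) (n + 2) rfl (d_cocycHom P Y (n + 1) _)
    congr 1
    exact hz.1.symm
  rw [h1, compare_newClass, compare_newClass]
  have h2 := ProjectiveResolution.isoLeftDerivedObj_hom_naturality f P P' φ.hom (by
    simpa using φ.hom_f_zero_comp_π_f_zero) (yonedaOp Y) (n + 1)
  have h3 := congrArg (fun g : (((yonedaOp Y).leftDerived (n + 1)).obj X) ⟶
    (homComplex P' Y).homology (n + 1) => g.unop (cocycπ _ (n + 1) z)) h2
  refine Eq.trans ?_ h3.symm
  exact congrArg (P.isoLeftDerivedObj (yonedaOp Y) (n + 1)).hom.unop.hom hz.2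

end Comparison

section LocalCohomology

open Limits

variable (J : Ideal A) (M : ModuleCat.{0} A) (i : ℕ)

/-- The map from `Ext (A ⧸ J ^ t, M)` to local cohomology. -/
def toLocalAux (t : ℕ) : Abelian.Ext (ModuleCat.of A (A ⧸ J ^ t)) M (i + 1) →ₗ[A]
    ((localCohomology J (i + 1)).obj M) :=
  ((colimit.ι (localCohomology.diagram (localCohomology.idealPowersDiagram J) (i + 1))
    (op (op t))).app M).hom ∘ₗ compare (projectiveResolution (ModuleCat.of A (A ⧸ J ^ t))) M i

lemma toLocalAux_trans {s t : ℕ} (h : s ≤ t)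
    (x : Abelian.Ext (ModuleCat.of A (A ⧸ J ^ s)) M (i + 1)) :
    toLocalAux J M i t (extTrans J (i + 1) M s t h x) = toLocalAux J M i s x := by
  have hw := colimit.w (localCohomology.diagram (localCohomology.idealPowersDiagram J) (i + 1))
    (homOfLE h).op.op
  have hn := compare_naturality (P := projectiveResolution (ModuleCat.of A (A ⧸ J ^ t)))
    (projectiveResolution (ModuleCat.of A (A ⧸ J ^ s))) (quotPowMap J h) x
  rw [extTrans_apply]
  refine (congrArg ((colimit.ι (localCohomology.diagram
    (localCohomology.idealPowersDiagram J) (i + 1)) (op (op t))).app M).hom hn).trans ?_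
  exact congrArg (fun φ : (localCohomology.diagram (localCohomology.idealPowersDiagram J)
    (i + 1)).obj (op (op s)) ⟶ localCohomology J (i + 1) =>
      (φ.app M).hom (compare (projectiveResolution (ModuleCat.of A (A ⧸ J ^ s))) M i x)) hw

/-- The comparison map to Mathlib's local cohomology. -/
def toLocal : T J (i + 1) M →ₗ[A] ((localCohomology J (i + 1)).obj M) :=
  Module.DirectLimit.lift A ℕ _ _ (toLocalAux J M i) fun _ _ h x => toLocalAux_trans J M i h x

lemma toLocal_injective : Function.Injective (toLocal J M i) := by
  rw [injective_iff_map_eq_zero]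
  intro x hx
  obtain ⟨t, x, rfl⟩ := Module.DirectLimit.exists_of x
  rw [toLocal, Module.DirectLimit.lift_of] at hx
  let D := localCohomology.diagram (localCohomology.idealPowersDiagram J) (i + 1)
  have hc : IsColimit (((evaluation _ _).obj M).mapCocone (colimit.cocone D)) :=
    isColimitOfPreserves _ (colimit.isColimit D)
  have hx' : (((evaluation _ _).obj M).mapCocone (colimit.cocone D)).ι.app (op (op t))
      (compare (projectiveResolution (ModuleCat.of A (A ⧸ J ^ t))) M i x) =
      (((evaluation _ _).obj M).mapCocone (colimit.cocone D)).ι.app (op (op t)) 0 :=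
    hx.trans (map_zero _).symm
  obtain ⟨k, f, hf⟩ := (IsColimit.eq_iff' hc _ _).1 hx'
  have h : t ≤ k.unop.unop := leOfHom f.unop.unop
  have hn := compare_naturality
    (P := projectiveResolution (ModuleCat.of A (A ⧸ J ^ k.unop.unop)))
    (projectiveResolution (ModuleCat.of A (A ⧸ J ^ t))) (quotPowMap J h) x
  rw [← ofExt_trans J h x]
  have h0 : (Abelian.Ext.mk₀ (quotPowMap J h)).comp x (zero_add (i + 1)) = 0 := by
    apply compare_injective (projectiveResolution (ModuleCat.of A (A ⧸ J ^ k.unop.unop)))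
    rw [hn, map_zero]
    exact hf.trans (map_zero _)
  rw [h0, map_zero]

end LocalCohomology

end OldExt

end TorsionExt

namespace DetSeries

variable {𝕜 : Type} [Field 𝕜] {m n : ℕ}

/-- The multidegrees: integer exponents of row and column parameters. -/
abbrev Deg (m n : ℕ) : Type := Fin m ⊕ Fin n → ℤ

/-- The multidegree of a monomial in the entries of the matrix: its row and column sums. -/
def deg (m n : ℕ) : (Fin m × Fin n →₀ ℕ) →+ Deg m n where
  toFun a := Sum.elim (fun i => ∑ j, (a (i, j) : ℤ)) (fun j => ∑ i, (a (i, j) : ℤ))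
  map_zero' := by
    ext s
    cases s <;> simp
  map_add' a b := by
    ext s
    cases s <;> simp [Finset.sum_add_distrib]

lemma deg_inl (a : Fin m × Fin n →₀ ℕ) (i : Fin m) : deg m n a (.inl i) = ∑ j, (a (i, j) : ℤ) :=
  rfl

lemma deg_inr (a : Fin m × Fin n →₀ ℕ) (j : Fin n) : deg m n a (.inr j) = ∑ i, (a (i, j) : ℤ) :=
  rfl

lemma deg_nonneg (a : Fin m × Fin n →₀ ℕ) : 0 ≤ deg m n a := by
  rintro (i | j)
  · change 0 ≤ ∑ j, (a (i, j) : ℤ)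
    exact Finset.sum_nonneg (f := fun j => (a (i, j) : ℤ)) fun j _ => Int.natCast_nonneg _
  · change 0 ≤ ∑ i, (a (i, j) : ℤ)
    exact Finset.sum_nonneg (f := fun i => (a (i, j) : ℤ)) fun i _ => Int.natCast_nonneg _

lemma le_deg_inl (a : Fin m × Fin n →₀ ℕ) (p : Fin m × Fin n) :
    (a p : ℤ) ≤ deg m n a (.inl p.1) :=
  Finset.single_le_sum (f := fun j => (a (p.1, j) : ℤ)) (fun _ _ => Int.natCast_nonneg _)
    (Finset.mem_univ p.2)

/-- A multidegree is balanced if its row and column parts have the same sum. -/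
def balanced (m n : ℕ) : AddSubgroup (Deg m n) where
  carrier := {d | ∑ i, d (.inl i) = ∑ j, d (.inr j)}
  zero_mem' := by simp
  add_mem' {d e} hd he := by
    simp only [Set.mem_ofPred_eq, Pi.add_apply, Finset.sum_add_distrib] at *
    rw [hd, he]
  neg_mem' {d} hd := by
    simp only [Set.mem_ofPred_eq, Pi.neg_apply, Finset.sum_neg_distrib] at *
    rw [hd]

lemma deg_mem_balanced (a : Fin m × Fin n →₀ ℕ) : deg m n a ∈ balanced m n := by
  change ∑ i, ∑ j, (a (i, j) : ℤ) = ∑ j, ∑ i, (a (i, j) : ℤ)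
  exact Finset.sum_comm

/-- The convolution of a power series with a function on multidegrees. -/
def conv (f : DetP 𝕜 m n) (u : Deg m n → 𝕜) (d : Deg m n) : 𝕜 :=
  ∑ᶠ a, coeff a f * u (d - deg m n a)

/-- A bound for the exponents of degree at most `d`. -/
def expBound (d : Deg m n) : Fin m × Fin n →₀ ℕ :=
  Finsupp.equivFunOnFinite.symm fun p => (d (.inl p.1)).toNat

lemma le_expBound {a : Fin m × Fin n →₀ ℕ} {d : Deg m n} (h : deg m n a ≤ d) :
    a ≤ expBound d := by
  intro p
  have h1 := le_deg_inl a p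
  have h2 := h (.inl p.1)
  change a p ≤ (d (.inl p.1)).toNat
  lia

lemma expBound_mono {d e : Deg m n} (h : d ≤ e) : expBound d ≤ expBound e := fun p =>
  Int.toNat_le_toNat (h (.inl p.1))

section Bounded

variable {u : Deg m n → 𝕜} {b : Deg m n}

lemma eq_zero_of_not_le (hb : ∀ d, u d ≠ 0 → b ≤ d) {d : Deg m n} {a N : Fin m × Fin n →₀ ℕ}
    (hN : expBound (d - b) ≤ N) (ha : ¬ a ≤ N) : u (d - deg m n a) = 0 := by
  by_contra h
  exact ha ((le_expBound (by have := hb _ h; exact le_sub_comm.mp this)).trans hN)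

lemma conv_eq_sum (hb : ∀ d, u d ≠ 0 → b ≤ d) (f : DetP 𝕜 m n) {d : Deg m n}
    {N : Fin m × Fin n →₀ ℕ} (hN : expBound (d - b) ≤ N) :
    conv f u d = ∑ a ∈ Finset.Iic N, coeff a f * u (d - deg m n a) := by
  refine finsum_eq_sum_of_support_subset _ fun a ha => ?_
  rw [Finset.coe_Iic, Set.mem_Iic]
  by_contra h
  exact ha (mul_eq_zero_of_right _ (eq_zero_of_not_le hb hN h))

lemma conv_bound (hb : ∀ d, u d ≠ 0 → b ≤ d) (f : DetP 𝕜 m n) (d : Deg m n)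
    (hd : conv f u d ≠ 0) : b ≤ d := by
  obtain ⟨a, ha⟩ : ∃ a, coeff a f * u (d - deg m n a) ≠ 0 := by
    by_contra! h
    exact hd (finsum_eq_zero_of_forall_eq_zero h)
  exact (hb _ (right_ne_zero_of_mul ha)).trans (sub_le_self _ (deg_nonneg a))

end Bounded

lemma conv_monomial (a : Fin m × Fin n →₀ ℕ) (r : 𝕜) (u : Deg m n → 𝕜) (d : Deg m n) :
    conv (monomial a r) u d = r * u (d - deg m n a) := by
  classical
  rw [conv, finsum_eq_single _ a, coeff_monomial_same]
  intro a' ha'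
  rw [coeff_monomial_ne ha', zero_mul]

lemma sum_antidiagonal {N : Fin m × Fin n →₀ ℕ}
    (F : (Fin m × Fin n →₀ ℕ) → (Fin m × Fin n →₀ ℕ) → 𝕜)
    (hF : ∀ b c, ¬ b + c ≤ N → F b c = 0) :
    ∑ a ∈ Finset.Iic N, ∑ p ∈ Finset.HasAntidiagonal.antidiagonal a, F p.1 p.2 =
      ∑ b ∈ Finset.Iic N, ∑ c ∈ Finset.Iic N, F b c := by
  classical
  symm
  rw [← Finset.sum_product', ← Finset.sum_filter_of_ne (p := fun x => x.1 + x.2 ≤ N)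
    (fun x _ h => by by_contra h'; exact h (hF _ _ h')),
    ← Finset.sum_fiberwise_of_maps_to (g := fun x => x.1 + x.2) (t := Finset.Iic N)
      (fun x hx => by simpa using (Finset.mem_filter.mp hx).2)]
  refine Finset.sum_congr rfl fun a ha => Finset.sum_congr ?_ fun _ _ => rfl
  ext ⟨b, c⟩
  simp only [Finset.HasAntidiagonal.mem_antidiagonal, Finset.mem_filter, Finset.mem_product,
    Finset.mem_Iic] at ha ⊢
  constructor
  · exact fun h => h.2
  · rintro rfl
    exact ⟨⟨⟨le_self_add.trans ha, le_add_self.trans ha⟩, ha⟩, rfl⟩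

/-- The sign conditions on a coordinate of a multidegree. -/
inductive Sgn
  | nonneg
  | free
  | neg

/-- The integers satisfying a sign condition. -/
def Sgn.set : Sgn → Set ℤ
  | nonneg => Set.Ici 0
  | free => Set.univ
  | neg => Set.Iio 0

/-- The order nonnegative, free, negative on sign conditions. -/
def Sgn.le : Sgn → Sgn → Prop
  | nonneg, _ => True
  | free, nonneg => False
  | free, _ => True
  | neg, neg => True
  | neg, _ => False

/-- A sign pattern on all coordinates. -/
abbrev Pat (m n : ℕ) : Type := Fin m ⊕ Fin n → Sgn

/-- The balanced multidegrees satisfying a sign pattern. -/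
def dom (τ : Pat m n) : Set (Deg m n) := {d | d ∈ balanced m n ∧ ∀ s, d s ∈ (τ s).set}

lemma Sgn.set_convex {t : Sgn} {x y z : ℤ} (hx : x ∈ t.set) (hz : z ∈ t.set) (hxy : x ≤ y)
    (hyz : y ≤ z) : y ∈ t.set := by
  cases t <;> simp only [Sgn.set, Set.mem_Ici, Set.mem_Iio, Set.mem_univ] at * <;> lia

lemma Sgn.mem_left {t t' : Sgn} (h : t.le t') {x y : ℤ} (hx : x ∈ t.set)
    (hy : y ∈ t'.set) (hx' : x ∈ t'.set) (hxy : x ≤ y) : y ∈ t.set := by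
  cases t <;> cases t' <;>
    simp only [Sgn.set, Sgn.le, Set.mem_Ici, Set.mem_Iio, Set.mem_univ] at * <;> lia

lemma Sgn.mem_right {t t' : Sgn} (h : t.le t') {x y : ℤ} (hx : x ∈ t.set)
    (hy : y ∈ t'.set) (hy' : y ∈ t.set) (hxy : x ≤ y) : x ∈ t'.set := by
  cases t <;> cases t' <;>
    simp only [Sgn.set, Sgn.le, Set.mem_Ici, Set.mem_Iio, Set.mem_univ] at * <;> lia

lemma Sgn.mem_mid {t t' t'' : Sgn} (h : t.le t') (h' : t'.le t'') {x : ℤ}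
    (hx : x ∈ t.set) (hx' : x ∈ t''.set) : x ∈ t'.set := by
  cases t <;> cases t' <;> cases t'' <;>
    simp only [Sgn.set, Sgn.le, Set.mem_Ici, Set.mem_Iio, Set.mem_univ] at * <;> lia

lemma Sgn.le_refl (t : Sgn) : t.le t := by cases t <;> trivial

lemma dom_convex {τ : Pat m n} {d : Deg m n} {b c : Fin m × Fin n →₀ ℕ} (hd : d ∈ dom τ)
    (h : d - deg m n b - deg m n c ∈ dom τ) : d - deg m n b ∈ dom τ :=
  ⟨sub_mem hd.1 (deg_mem_balanced b), fun s => Sgn.set_convex (h.2 s) (hd.2 s)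
    (by have := deg_nonneg c s; simpa using this) (by have := deg_nonneg b s; simpa using this)⟩

variable (𝕜) in
/-- The series with support in `dom τ` and bounded below. -/
def ser (τ : Pat m n) : Submodule 𝕜 (Deg m n → 𝕜) where
  carrier := {u | (∀ d, u d ≠ 0 → d ∈ dom τ) ∧ ∃ b : Deg m n, ∀ d, u d ≠ 0 → b ≤ d}
  zero_mem' := ⟨fun d h => (h rfl).elim, 0, fun d h => (h rfl).elim⟩
  add_mem' := by
    rintro u v ⟨hu, b, hb⟩ ⟨hv, c, hc⟩
    have key : ∀ d, (u + v) d ≠ 0 → u d ≠ 0 ∨ v d ≠ 0 := by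
      intro d h
      by_contra! h'
      exact h (by rw [Pi.add_apply, h'.1, h'.2, add_zero])
    refine ⟨fun d h => (key d h).elim (hu d) (hv d), b ⊓ c, fun d h => ?_⟩
    exact (key d h).elim (fun h => inf_le_left.trans (hb d h)) fun h => inf_le_right.trans (hc d h)
  smul_mem' := by
    rintro r u ⟨hu, b, hb⟩
    exact ⟨fun d h => hu d (right_ne_zero_of_mul h), b, fun d h => hb d (right_ne_zero_of_mul h)⟩

variable (𝕜) in
/-- The module of series with support in `dom τ`. -/
def Ser (τ : Pat m n) : Type := ser 𝕜 τ

namespace Ser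

variable {τ : Pat m n}

instance : AddCommGroup (Ser 𝕜 τ) := inferInstanceAs (AddCommGroup (ser 𝕜 τ))

/-- The coefficient of a series. -/
def val (u : Ser 𝕜 τ) : Deg m n → 𝕜 := Subtype.val u

@[ext] lemma ext {u v : Ser 𝕜 τ} (h : ∀ d, u.val d = v.val d) : u = v := Subtype.ext (funext h)

@[simp] lemma val_add (u v : Ser 𝕜 τ) (d : Deg m n) : (u + v).val d = u.val d + v.val d := rfl

@[simp] lemma val_sub (u v : Ser 𝕜 τ) (d : Deg m n) : (u - v).val d = u.val d - v.val d := rfl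

@[simp] lemma val_zero (d : Deg m n) : (0 : Ser 𝕜 τ).val d = 0 := rfl

lemma mem_dom (u : Ser 𝕜 τ) {d : Deg m n} (h : u.val d ≠ 0) : d ∈ dom τ := u.2.1 d h

lemma bound (u : Ser 𝕜 τ) : ∃ b : Deg m n, ∀ d, u.val d ≠ 0 → b ≤ d := u.2.2

lemma val_eq_zero (u : Ser 𝕜 τ) {d : Deg m n} (h : d ∉ dom τ) : u.val d = 0 := by
  by_contra h'
  exact h (u.mem_dom h')

instance : SMul (DetP 𝕜 m n) (Ser 𝕜 τ) where
  smul f u := ⟨(dom τ).indicator (conv f u.val), fun _ h => Set.mem_of_indicator_ne_zero h, by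
    obtain ⟨b, hb⟩ := u.bound
    refine ⟨b, fun d h => conv_bound hb f d ?_⟩
    rw [Set.indicator_of_mem (Set.mem_of_indicator_ne_zero h)] at h
    exact h⟩

lemma val_smul (f : DetP 𝕜 m n) (u : Ser 𝕜 τ) {d : Deg m n} (hd : d ∈ dom τ) :
    (f • u).val d = conv f u.val d := Set.indicator_of_mem hd _

lemma val_monomial_smul (a : Fin m × Fin n →₀ ℕ) (r : 𝕜) (u : Ser 𝕜 τ) {d : Deg m n}
    (hd : d ∈ dom τ) : ((monomial a r : DetP 𝕜 m n) • u).val d = r * u.val (d - deg m n a) := by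
  rw [val_smul _ _ hd, conv_monomial]

/-- Equality of series can be checked on `dom τ`. -/
lemma ext_dom {u v : Ser 𝕜 τ} (h : ∀ d ∈ dom τ, u.val d = v.val d) : u = v := by
  ext d
  by_cases hd : d ∈ dom τ
  · exact h d hd
  · rw [val_eq_zero _ hd, val_eq_zero _ hd]

instance : Module (DetP 𝕜 m n) (Ser 𝕜 τ) where
  one_smul u := by
    refine ext_dom fun d hd => ?_
    have := val_monomial_smul 0 1 u hd
    rw [map_zero, sub_zero, one_mul] at this
    exact this
  mul_smul f g u := by
    refine ext_dom fun d hd => ?_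
    obtain ⟨b, hb⟩ := u.bound
    have hgb : ∀ d, (g • u).val d ≠ 0 → b ≤ d := fun d h => by
      rw [val_smul _ _ (mem_dom _ h)] at h
      exact conv_bound hb g d h
    rw [val_smul _ _ hd, val_smul _ _ hd, conv_eq_sum hb _ le_rfl, conv_eq_sum hgb _ le_rfl]
    classical
    have h1 : ∀ p, (g • u).val (d - deg m n p) = ∑ c ∈ Finset.Iic (expBound (d - b)),
        coeff c g * u.val (d - deg m n p - deg m n c) := by
      intro p
      by_cases hp : d - deg m n p ∈ dom τ
      · rw [val_smul _ _ hp]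
        exact conv_eq_sum hb _ (expBound_mono
          (sub_le_sub_right (sub_le_self _ (deg_nonneg p)) b))
      · rw [val_eq_zero _ hp]
        refine (Finset.sum_eq_zero fun c _ => ?_).symm
        rw [val_eq_zero _ (fun h => hp (dom_convex hd h)), mul_zero]
    simp_rw [h1, Finset.mul_sum]
    rw [← sum_antidiagonal]
    · refine Finset.sum_congr rfl fun a _ => ?_
      rw [coeff_mul, Finset.sum_mul]
      refine Finset.sum_congr rfl fun p hp => ?_
      rw [← Finset.HasAntidiagonal.mem_antidiagonal.mp hp, map_add, sub_sub, mul_assoc]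
    · intro p c h
      rw [sub_sub, ← map_add, eq_zero_of_not_le hb le_rfl h, mul_zero, mul_zero]
  smul_zero f := by
    refine ext_dom fun d hd => ?_
    rw [val_smul _ _ hd, conv, val_zero]
    exact finsum_eq_zero_of_forall_eq_zero fun a => mul_zero _
  smul_add f u v := by
    refine ext_dom fun d hd => ?_
    obtain ⟨b, hb⟩ := u.bound
    obtain ⟨c, hc⟩ := v.bound
    obtain ⟨e, he⟩ := (u + v).bound
    let N := expBound (d - b) ⊔ expBound (d - c) ⊔ expBound (d - e)
    rw [val_add, val_smul _ _ hd, val_smul _ _ hd, val_smul _ _ hd,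
      conv_eq_sum hb _ (N := N) (le_sup_left.trans le_sup_left),
      conv_eq_sum hc _ (N := N) (le_sup_right.trans le_sup_left),
      conv_eq_sum he _ (N := N) le_sup_right, ← Finset.sum_add_distrib]
    exact Finset.sum_congr rfl fun a _ => mul_add _ _ _
  add_smul f g u := by
    refine ext_dom fun d hd => ?_
    obtain ⟨b, hb⟩ := u.bound
    rw [val_add, val_smul _ _ hd, val_smul _ _ hd, val_smul _ _ hd,
      conv_eq_sum hb _ le_rfl, conv_eq_sum hb _ le_rfl, conv_eq_sum hb _ le_rfl,
      ← Finset.sum_add_distrib]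
    exact Finset.sum_congr rfl fun a _ => by rw [map_add, add_mul]
  zero_smul u := by
    refine ext_dom fun d hd => ?_
    rw [val_smul _ _ hd, conv, val_zero]
    exact finsum_eq_zero_of_forall_eq_zero fun a => by rw [map_zero, zero_mul]

end Ser

end DetSeries

namespace DetSeries

variable {𝕜 : Type} [Field 𝕜] {m n : ℕ}

/-- The multidegree of a matrix entry. -/
def entryDeg (i : Fin m) (j : Fin n) : Deg m n := deg m n (Finsupp.single (i, j) 1)

lemma entryDeg_inl (i : Fin m) (j : Fin n) (i' : Fin m) :
    entryDeg i j (.inl i') = if i' = i then 1 else 0 := by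
  classical
  rw [entryDeg, deg_inl]
  by_cases h : i' = i
  · subst h
    simp [Finsupp.single_apply]
  · simp [h]

lemma entryDeg_inr (i : Fin m) (j j' : Fin n) :
    entryDeg i j (.inr j') = if j' = j then 1 else 0 := by
  classical
  rw [entryDeg, deg_inr]
  by_cases h : j' = j
  · subst h
    simp [Finsupp.single_apply]
  · simp [h]

lemma entryDeg_mem_balanced (i : Fin m) (j : Fin n) : entryDeg i j ∈ balanced m n :=
  deg_mem_balanced _

lemma entryDeg_add (i k : Fin m) (j l : Fin n) :
    entryDeg i j + entryDeg k l = entryDeg i l + entryDeg k j := by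
  ext (s | s) <;> simp only [Pi.add_apply, entryDeg_inl, entryDeg_inr, add_comm]

namespace Ser

variable {τ : Pat m n}

lemma val_X_pow_smul (i : Fin m) (j : Fin n) (N : ℕ) (u : Ser 𝕜 τ) {d : Deg m n}
    (hd : d ∈ dom τ) :
    ((X (i, j) : DetP 𝕜 m n) ^ N • u).val d = u.val (d - N • entryDeg i j) := by
  have h : (X (i, j) : DetP 𝕜 m n) ^ N = monomial (N • Finsupp.single (i, j) 1) 1 := by
    rw [X, monomial_pow, one_pow]
  rw [h, val_monomial_smul _ _ _ hd, one_mul, map_nsmul]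
  rfl

lemma val_X_mul_X_smul (i k : Fin m) (j l : Fin n) (u : Ser 𝕜 τ) {d : Deg m n}
    (hd : d ∈ dom τ) : ((X (i, j) * X (k, l) : DetP 𝕜 m n) • u).val d =
      u.val (d - (entryDeg i j + entryDeg k l)) := by
  rw [X, X, monomial_mul_monomial, val_monomial_smul _ _ _ hd, one_mul, one_mul, map_add]
  rfl

lemma isTorsionBySet : Module.IsTorsionBySet (DetP 𝕜 m n) (Ser 𝕜 τ)
    (detI2 𝕜 m n : Set (DetP 𝕜 m n)) := by
  rw [Module.isTorsionBySet_iff_subset_annihilator, SetLike.coe_subset_coe, detI2, Ideal.span_le]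
  rintro f ⟨i, k, j, l, -, -, rfl⟩
  refine Module.mem_annihilator.mpr fun u => ext_dom fun d hd => ?_
  rw [sub_smul, val_sub, val_X_mul_X_smul _ _ _ _ _ hd, val_X_mul_X_smul _ _ _ _ _ hd,
    entryDeg_add, sub_self, val_zero]

instance : Module (DetR 𝕜 m n) (Ser 𝕜 τ) := (isTorsionBySet (𝕜 := 𝕜) (τ := τ)).module

lemma mk_smul (f : DetP 𝕜 m n) (u : Ser 𝕜 τ) :
    (Ideal.Quotient.mk (detI2 𝕜 m n) f) • u = f • u :=
  (isTorsionBySet (𝕜 := 𝕜) (τ := τ)).mk_smul f u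

/-- The linear map over the determinantal ring given by a map linear over power series. -/
def linMk {M N : Type} [AddCommGroup M] [AddCommGroup N] [Module (DetR 𝕜 m n) M]
    [Module (DetR 𝕜 m n) N] (φ : M →+ N)
    (h : ∀ f : DetP 𝕜 m n, ∀ u, φ (Ideal.Quotient.mk (detI2 𝕜 m n) f • u) =
      Ideal.Quotient.mk (detI2 𝕜 m n) f • φ u) : M →ₗ[DetR 𝕜 m n] N where
  toFun := φ
  map_add' := map_add φ
  map_smul' r u := by
    obtain ⟨f, rfl⟩ := Ideal.Quotient.mk_surjective r
    exact h f u

section Res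

variable {τ' : Pat m n}

/-- Restriction of the support, as an additive map. -/
def resAux (τ τ' : Pat m n) : Ser 𝕜 τ →+ Ser 𝕜 τ' where
  toFun u := ⟨(dom τ').indicator u.val, fun _ h => Set.mem_of_indicator_ne_zero h, by
    obtain ⟨b, hb⟩ := u.bound
    refine ⟨b, fun d h => hb d ?_⟩
    rwa [Set.indicator_of_mem (Set.mem_of_indicator_ne_zero h)] at h⟩
  map_zero' := Subtype.ext (Set.indicator_zero _ _)
  map_add' u v := Subtype.ext (Set.indicator_add _ _ _)

lemma resAux_val (u : Ser 𝕜 τ) {d : Deg m n} (hd : d ∈ dom τ') :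
    (resAux τ τ' u).val d = u.val d := Set.indicator_of_mem hd _

lemma resAux_smul (h : ∀ s, (τ s).le (τ' s)) (f : DetP 𝕜 m n) (u : Ser 𝕜 τ) :
    resAux τ τ' (f • u) = f • resAux τ τ' u := by
  refine ext_dom fun d hd => ?_
  rw [resAux_val _ hd, val_smul _ _ hd]
  by_cases hd' : d ∈ dom τ
  · rw [val_smul _ _ hd', conv, conv]
    refine finsum_congr fun a => ?_
    by_cases ha : u.val (d - deg m n a) = 0
    · by_cases ha' : d - deg m n a ∈ dom τ'
      · rw [resAux_val _ ha']
      · rw [ha, val_eq_zero _ ha']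
    · rw [resAux_val]
      have hm := u.mem_dom ha
      exact ⟨hm.1, fun s => Sgn.mem_right (h s) (hm.2 s) (hd.2 s) (hd'.2 s)
        (by have := deg_nonneg a s; simpa using this)⟩
  · rw [val_eq_zero _ hd', conv]
    refine (finsum_eq_zero_of_forall_eq_zero fun a => mul_eq_zero_of_right _ ?_).symm
    by_contra ha
    have hm := (resAux τ τ' u).mem_dom ha
    rw [resAux_val _ hm] at ha
    have hm' := u.mem_dom ha
    exact hd' ⟨hd.1, fun s => Sgn.mem_left (h s) (hm'.2 s) (hd.2 s) (hm.2 s)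
        (by have := deg_nonneg a s; simpa using this)⟩

/-- Restriction of the support. -/
def res (h : ∀ s, (τ s).le (τ' s)) : Ser 𝕜 τ →ₗ[DetR 𝕜 m n] Ser 𝕜 τ' :=
  linMk (resAux τ τ') fun f u => by rw [mk_smul, mk_smul, resAux_smul h]

lemma res_val (h : ∀ s, (τ s).le (τ' s)) (u : Ser 𝕜 τ) {d : Deg m n} (hd : d ∈ dom τ') :
    (res h u).val d = u.val d := resAux_val u hd

lemma res_val_of_mem (h : ∀ s, (τ s).le (τ' s)) (u : Ser 𝕜 τ) {d : Deg m n}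
    (hd : d ∉ dom τ) : (res h u).val d = 0 := by
  by_contra h'
  have := (res h u).mem_dom h'
  rw [res_val h u this] at h'
  exact hd (u.mem_dom h')

lemma res_res {τ'' : Pat m n} (h : ∀ s, (τ s).le (τ' s)) (h' : ∀ s, (τ' s).le (τ'' s))
    (h'' : ∀ s, (τ s).le (τ'' s)) (u : Ser 𝕜 τ) : res h' (res h u) = res h'' u := by
  refine ext_dom fun d hd => ?_
  rw [res_val _ _ hd, res_val _ _ hd]
  by_cases hd' : d ∈ dom τ
  · exact res_val _ _ ⟨hd.1, fun s => Sgn.mem_mid (h s) (h' s) (hd'.2 s) (hd.2 s)⟩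
  · rw [res_val_of_mem _ _ hd', val_eq_zero _ hd']

/-- Two patterns are the same except at `s`, where the sign conditions are as given. -/
structure Step (s : Fin m ⊕ Fin n) (τ₀ τ₁ τ₂ : Pat m n) : Prop where
  fst : τ₀ s = .nonneg
  snd : τ₁ s = .free
  thd : τ₂ s = .neg
  eq₀₁ : ∀ s' ≠ s, τ₀ s' = τ₁ s'
  eq₁₂ : ∀ s' ≠ s, τ₁ s' = τ₂ s'

namespace Step

variable {s : Fin m ⊕ Fin n} {τ₀ τ₁ τ₂ : Pat m n}

lemma le₀₁ (H : Step s τ₀ τ₁ τ₂) (s' : Fin m ⊕ Fin n) : (τ₀ s').le (τ₁ s') := by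
  by_cases h : s' = s
  · rw [h, H.fst, H.snd]; trivial
  · rw [H.eq₀₁ s' h]; exact Sgn.le_refl _

lemma le₁₂ (H : Step s τ₀ τ₁ τ₂) (s' : Fin m ⊕ Fin n) : (τ₁ s').le (τ₂ s') := by
  by_cases h : s' = s
  · rw [h, H.thd, H.snd]; trivial
  · rw [H.eq₁₂ s' h]; exact Sgn.le_refl _

lemma dom₀₁ (H : Step s τ₀ τ₁ τ₂) {d : Deg m n} (hd : d ∈ dom τ₀) : d ∈ dom τ₁ := by
  refine ⟨hd.1, fun s' => ?_⟩
  by_cases h : s' = s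
  · rw [h, H.snd]; trivial
  · rw [← H.eq₀₁ s' h]; exact hd.2 s'

lemma dom₂₁ (H : Step s τ₀ τ₁ τ₂) {d : Deg m n} (hd : d ∈ dom τ₂) : d ∈ dom τ₁ := by
  refine ⟨hd.1, fun s' => ?_⟩
  by_cases h : s' = s
  · rw [h, H.snd]; trivial
  · rw [H.eq₁₂ s' h]; exact hd.2 s'

lemma not_dom₂ (H : Step s τ₀ τ₁ τ₂) {d : Deg m n} (hd : d ∈ dom τ₀) : d ∉ dom τ₂ := fun h => by
  have h1 := hd.2 s
  have h2 := h.2 s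
  rw [H.fst] at h1
  rw [H.thd] at h2
  exact not_lt_of_ge (show 0 ≤ d s from h1) h2

lemma dom₀ (H : Step s τ₀ τ₁ τ₂) {d : Deg m n} (hd : d ∈ dom τ₁) (h : d ∉ dom τ₂) : d ∈ dom τ₀ := by
  have hs : ¬ d s < 0 := fun hs => h ⟨hd.1, fun s' => by
    by_cases h' : s' = s
    · rw [h', H.thd]; exact hs
    · rw [← H.eq₁₂ s' h']; exact hd.2 s'⟩
  refine ⟨hd.1, fun s' => ?_⟩
  by_cases h' : s' = s
  · rw [h', H.fst]; exact not_lt.mp hs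
  · rw [H.eq₀₁ s' h']; exact hd.2 s'

lemma res_injective (H : Step s τ₀ τ₁ τ₂) : Function.Injective (res (𝕜 := 𝕜) H.le₀₁) := by
  intro u v h
  refine ext_dom fun d hd => ?_
  rw [← res_val H.le₀₁ u (H.dom₀₁ hd), h, res_val _ _ (H.dom₀₁ hd)]

lemma res_surjective (H : Step s τ₀ τ₁ τ₂) : Function.Surjective (res (𝕜 := 𝕜) H.le₁₂) := by
  intro u
  refine ⟨resAux τ₂ τ₁ u, ext_dom fun d hd => ?_⟩
  rw [res_val _ _ hd, resAux_val _ (H.dom₂₁ hd)]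

lemma res_exact (H : Step s τ₀ τ₁ τ₂) :
    Function.Exact (res (𝕜 := 𝕜) H.le₀₁) (res (𝕜 := 𝕜) H.le₁₂) := by
  intro u
  constructor
  · intro h
    refine ⟨resAux τ₁ τ₀ u, ext_dom fun d hd => ?_⟩
    rw [res_val _ _ hd]
    by_cases hd' : d ∈ dom τ₂
    · rw [← res_val H.le₁₂ u hd', h, val_zero, val_eq_zero _ fun h0 => H.not_dom₂ h0 hd']
    · exact resAux_val _ (H.dom₀ hd hd')
  · rintro ⟨v, rfl⟩
    refine ext_dom fun d hd => ?_
    rw [res_val _ _ hd, res_val_of_mem _ _ fun h0 => H.not_dom₂ h0 hd, val_zero]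

end Step

end Res

lemma bijective_smul {i : Fin m} {j : Fin n} (hi : τ (.inl i) = .free) (hj : τ (.inr j) = .free) :
    Function.Bijective fun u : Ser 𝕜 τ => detx 𝕜 m n i j • u := by
  have hfree : ∀ s, τ s ≠ .free → entryDeg i j s = 0 := by
    rintro (s | s) hs
    · rw [entryDeg_inl, if_neg (fun h => hs (by rw [h, hi]))]
    · rw [entryDeg_inr, if_neg (fun h => hs (by rw [h, hj]))]
  have hdom : ∀ d d', d ∈ dom τ → d' ∈ balanced m n → (∀ s, τ s ≠ .free → d' s = d s) →
      d' ∈ dom τ := fun d d' hd hd' h => ⟨hd', fun s => by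
    by_cases hs : τ s = .free
    · rw [hs]; trivial
    · rw [h s hs]; exact hd.2 s⟩
  have hadd : ∀ d ∈ dom τ, d + entryDeg i j ∈ dom τ := fun d hd =>
    hdom d _ hd (add_mem hd.1 (entryDeg_mem_balanced i j)) fun s hs => by
      rw [Pi.add_apply, hfree s hs, add_zero]
  have hsub : ∀ d ∈ dom τ, d - entryDeg i j ∈ dom τ := fun d hd =>
    hdom d _ hd (sub_mem hd.1 (entryDeg_mem_balanced i j)) fun s hs => by
      rw [Pi.sub_apply, hfree s hs, sub_zero]
  have hval : ∀ (u : Ser 𝕜 τ), ∀ d ∈ dom τ,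
      (detx 𝕜 m n i j • u).val d = u.val (d - entryDeg i j) := fun u d hd => by
    rw [detx, mk_smul, ← pow_one (X (i, j)), val_X_pow_smul i j 1 u hd, one_smul]
  constructor
  · intro u v h
    refine ext_dom fun d hd => ?_
    have h' := congrArg (fun w : Ser 𝕜 τ => w.val (d + entryDeg i j)) h
    simp only [hval _ _ (hadd d hd), add_sub_cancel_right] at h'
    exact h'
  · intro u
    obtain ⟨b, hb⟩ := u.bound
    refine ⟨⟨fun d => u.val (d + entryDeg i j), fun d hd => ?_, b - entryDeg i j,
      fun d hd => sub_le_iff_le_add.mpr (hb _ hd)⟩, ext_dom fun d hd => ?_⟩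
    · rw [← add_sub_cancel_right d (entryDeg i j)]
      exact hsub _ (u.mem_dom hd)
    · refine (hval _ _ hd).trans ?_
      exact congrArg u.val (sub_add_cancel d _)

lemma exists_pow_smul_eq_zero {i : Fin m} {j : Fin n} {s : Fin m ⊕ Fin n} (hs : τ s = .neg)
    (he : entryDeg i j s = 1) (u : Ser 𝕜 τ) : ∃ N : ℕ, detx 𝕜 m n i j ^ N • u = 0 := by
  obtain ⟨b, hb⟩ := u.bound
  refine ⟨(-b s).toNat, ext_dom fun d hd => ?_⟩
  rw [detx, ← map_pow, mk_smul, val_X_pow_smul _ _ _ _ hd, val_zero]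
  by_contra h
  have h1 := hb _ h s
  have h2 := hd.2 s
  rw [hs] at h2
  have h3 : d s < 0 := h2
  rw [Pi.sub_apply, Pi.smul_apply, he, nsmul_one] at h1
  lia

lemma isTors (hτ : ∀ (i : Fin m) (j : Fin n), (j : ℕ) < n - 1 →
      τ (.inl i) = .neg ∨ τ (.inr j) = .neg) :
    TorsionExt.IsTors (detJ 𝕜 m n) (Ser 𝕜 τ) := by
  intro u
  have hle : detJ 𝕜 m n ≤ Ideal.radical
      (LinearMap.ker (LinearMap.toSpanSingleton (DetR 𝕜 m n) _ u)) := by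
    rw [detJ, Ideal.span_le]
    rintro _ ⟨i, j, hj, rfl⟩
    rcases hτ i j hj with h | h
    · obtain ⟨N, hN⟩ := exists_pow_smul_eq_zero (j := j) h (by rw [entryDeg_inl, if_pos rfl]) u
      exact ⟨N, hN⟩
    · obtain ⟨N, hN⟩ := exists_pow_smul_eq_zero (i := i) h (by rw [entryDeg_inr, if_pos rfl]) u
      exact ⟨N, hN⟩
  obtain ⟨t, ht⟩ := Ideal.exists_pow_le_of_le_radical_of_fg hle
    ((isNoetherianRing_iff_ideal_fg (DetR 𝕜 m n)).mp inferInstance _)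
  exact ⟨t, fun a ha => ht ha⟩

end Ser

end DetSeries

namespace DetSeries

variable {𝕜 : Type} [Field 𝕜] {m n : ℕ}

lemma exists_eq_add_single {a : Fin m × Fin n →₀ ℕ} {p : Fin m × Fin n} (h : a p ≠ 0) :
    ∃ b, a = b + Finsupp.single p 1 :=
  ⟨a - Finsupp.single p 1, (tsub_add_cancel_of_le
    (Finsupp.single_le_iff.mpr (Nat.one_le_iff_ne_zero.mpr h))).symm⟩

lemma deg_single (i : Fin m) (j : Fin n) :
    deg m n (Finsupp.single (i, j) 1) = entryDeg i j := rfl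

lemma exists_row {a : Fin m × Fin n →₀ ℕ} {i : Fin m} (h : 0 < deg m n a (.inl i)) :
    ∃ j, a (i, j) ≠ 0 := by
  by_contra! h'
  rw [deg_inl] at h
  simp [h'] at h

lemma exists_col {a : Fin m × Fin n →₀ ℕ} {j : Fin n} (h : 0 < deg m n a (.inr j)) :
    ∃ i, a (i, j) ≠ 0 := by
  by_contra! h'
  rw [deg_inr] at h
  simp [h'] at h

lemma detx_mul_detx (i k : Fin m) (j l : Fin n) :
    detx 𝕜 m n i j * detx 𝕜 m n k l = detx 𝕜 m n i l * detx 𝕜 m n k j := by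
  have key : ∀ (i k : Fin m) (j l : Fin n), i < k → j < l →
      detx 𝕜 m n i j * detx 𝕜 m n k l = detx 𝕜 m n i l * detx 𝕜 m n k j := by
    intro i k j l hik hjl
    simp only [detx, ← map_mul]
    exact Ideal.Quotient.eq.mpr (Ideal.subset_span ⟨i, k, j, l, hik, hjl, rfl⟩)
  rcases lt_trichotomy i k with hik | rfl | hik
  · rcases lt_trichotomy j l with hjl | rfl | hjl
    · exact key i k j l hik hjl
    · rfl
    · exact (key i k l j hik hjl).symm
  · exact mul_comm _ _
  · rcases lt_trichotomy j l with hjl | rfl | hjl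
    · rw [mul_comm, ← key k i j l hik hjl, mul_comm]
    · rfl
    · rw [mul_comm, key k i l j hik hjl, mul_comm]

variable (𝕜) in
/-- The class of a monomial in the determinantal ring. -/
def mon (a : Fin m × Fin n →₀ ℕ) : DetR 𝕜 m n :=
  Ideal.Quotient.mk (detI2 𝕜 m n) (monomial a 1)

lemma mon_add (a b : Fin m × Fin n →₀ ℕ) : mon 𝕜 (a + b) = mon 𝕜 a * mon 𝕜 b := by
  rw [mon, mon, mon, ← map_mul, monomial_mul_monomial, one_mul]

lemma mon_single (i : Fin m) (j : Fin n) :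
    mon 𝕜 (Finsupp.single (i, j) 1) = detx 𝕜 m n i j := rfl

lemma mon_eq_of_deg_eq (a a' : Fin m × Fin n →₀ ℕ) (h : deg m n a = deg m n a') :
    mon 𝕜 a = mon 𝕜 a' := by
  induction hN : a.degree generalizing a a' with
  | zero =>
    rw [Finsupp.degree_eq_zero_iff] at hN
    subst hN
    rw [map_zero] at h
    congr 1
    ext p
    have := le_deg_inl a' p
    rw [← h] at this
    exact (Nat.le_zero.mp (Int.ofNat_le.mp this)).symm
  | succ N ih =>
    have ha : a ≠ 0 := by
      rintro rfl
      simp at hN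
    obtain ⟨⟨i, j⟩, hp⟩ := Finsupp.ne_iff.mp ha
    have step : ∀ b, deg m n a = deg m n b → b (i, j) ≠ 0 → mon 𝕜 a = mon 𝕜 b := by
      intro b hb hbp
      obtain ⟨a₁, rfl⟩ := exists_eq_add_single hp
      obtain ⟨b₁, rfl⟩ := exists_eq_add_single hbp
      rw [map_add, map_add] at hb
      rw [map_add, Finsupp.degree_single] at hN
      rw [mon_add, mon_add, ih a₁ b₁ (add_right_cancel hb) (by lia)]
    by_cases hp' : a' (i, j) = 0
    · have hi : 0 < deg m n a' (.inl i) := by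
        rw [← h]
        exact (Int.natCast_pos.mpr (Nat.pos_of_ne_zero hp)).trans_le (le_deg_inl a (i, j))
      have hj : 0 < deg m n a' (.inr j) := by
        rw [← h, deg_inr]
        exact (Int.natCast_pos.mpr (Nat.pos_of_ne_zero hp)).trans_le
          (Finset.single_le_sum (f := fun i => (a (i, j) : ℤ)) (fun _ _ => Int.natCast_nonneg _)
            (Finset.mem_univ i))
      obtain ⟨l, hl⟩ := exists_row hi
      obtain ⟨k, hk⟩ := exists_col hj
      obtain ⟨b, rfl⟩ := exists_eq_add_single hl
      have hne : (i, l) ≠ (k, j) := by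
        rintro h
        rw [Prod.mk.injEq] at h
        rw [← h.1] at hk
        exact hk hp'
      have hk' : b (k, j) ≠ 0 := by
        rwa [Finsupp.add_apply, Finsupp.single_eq_of_ne hne.symm, add_zero] at hk
      obtain ⟨c, rfl⟩ := exists_eq_add_single hk'
      rw [step (c + Finsupp.single (k, l) 1 + Finsupp.single (i, j) 1)]
      · rw [mon_add, mon_add, mon_add, mon_add, mon_single, mon_single, mon_single, mon_single,
          mul_assoc, mul_assoc, detx_mul_detx]
      · rw [h, map_add, map_add, map_add, map_add, deg_single, deg_single, deg_single, deg_single,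
          add_assoc, add_assoc, entryDeg_add]
      · simp
    · exact step a' h hp'

lemma exists_deg_eq (d : Deg m n) (hd : d ∈ balanced m n) (h0 : 0 ≤ d) :
    ∃ a, deg m n a = d := by
  induction hN : (∑ i, d (.inl i)).toNat generalizing d with
  | zero =>
    refine ⟨0, ?_⟩
    have h1 : ∑ i, d (.inl i) = 0 :=
      le_antisymm (Int.toNat_eq_zero.mp hN) (Finset.sum_nonneg fun i _ => h0 (.inl i))
    have h2 : ∑ j, d (.inr j) = 0 := (show _ = _ from hd).symm.trans h1
    rw [map_zero]
    ext (s | s)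
    · exact ((Finset.sum_eq_zero_iff_of_nonneg fun i _ => h0 (.inl i)).mp h1 s
        (Finset.mem_univ s)).symm
    · exact ((Finset.sum_eq_zero_iff_of_nonneg fun i _ => h0 (.inr i)).mp h2 s
        (Finset.mem_univ s)).symm
  | succ N ih =>
    have h1 : 0 < ∑ i, d (.inl i) := by lia
    have h2 : 0 < ∑ j, d (.inr j) := h1.trans_eq hd
    obtain ⟨i, -, hi⟩ := Finset.exists_lt_of_sum_lt (s := Finset.univ)
      (f := fun _ : Fin m => (0 : ℤ))
      (g := fun i => d (.inl i)) (by simpa using h1)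
    obtain ⟨j, -, hj⟩ := Finset.exists_lt_of_sum_lt (s := Finset.univ)
      (f := fun _ : Fin n => (0 : ℤ))
      (g := fun j => d (.inr j)) (by simpa using h2)
    obtain ⟨a, ha⟩ := ih (d - entryDeg i j) (sub_mem hd (entryDeg_mem_balanced i j)) (by
      rintro (s | s)
      · have := h0 (.inl s)
        rw [Pi.sub_apply, entryDeg_inl]
        simp only [Pi.zero_apply] at *
        split_ifs with h
        · subst h; lia
        · lia
      · have := h0 (.inr s)
        rw [Pi.sub_apply, entryDeg_inr]
        simp only [Pi.zero_apply] at *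
        split_ifs with h
        · subst h; lia
        · lia) (by
      have : ∑ s, (d - entryDeg i j) (.inl s) = ∑ s, d (.inl s) - 1 := by
        simp [entryDeg_inl]
      lia)
    exact ⟨a + Finsupp.single (i, j) 1, by rw [map_add, ha, deg_single, sub_add_cancel]⟩

lemma mem_maximalIdeal_pow {f : DetP 𝕜 m n} {N : ℕ}
    (h : ∀ a : Fin m × Fin n →₀ ℕ, (∀ p, a p < N) → coeff a f = 0) :
    f ∈ IsLocalRing.maximalIdeal (DetP 𝕜 m n) ^ N := by
  classical
  have hc : ∀ a : Fin m × Fin n →₀ ℕ, ∃ p : Option (Fin m × Fin n),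
      (p = none → coeff a f = 0) ∧ ∀ q, p = some q → N ≤ a q := by
    intro a
    by_cases ha : ∀ p, a p < N
    · exact ⟨none, fun _ => h a ha, fun q hq => by cases hq⟩
    · push Not at ha
      obtain ⟨p, hp⟩ := ha
      exact ⟨some p, fun hq => (Option.some_ne_none p hq).elim, fun q hq => Option.some.inj hq ▸ hp⟩
  choose c hc₁ hc₂ using hc
  let g (p : Fin m × Fin n) : DetP 𝕜 m n := fun a => if c a = some p then coeff a f else 0
  have hg : ∀ p a, coeff a (g p) = if c a = some p then coeff a f else 0 := fun p a => rfl
  have hf : f = ∑ p, g p := by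
    ext a
    rw [map_sum]
    simp_rw [hg]
    rcases hca : c a with _ | p
    · simp [hc₁ a hca]
    · simp
  rw [hf]
  refine Ideal.sum_mem _ fun p _ => ?_
  obtain ⟨r, hr⟩ : (X p : DetP 𝕜 m n) ^ N ∣ g p := by
    rw [X_pow_dvd_iff]
    intro a ha
    rw [hg, if_neg fun h => absurd (hc₂ a p h) (by lia)]
  rw [hr]
  refine Ideal.mul_mem_right _ _ (Ideal.pow_mem_pow ?_ N)
  rw [IsLocalRing.mem_maximalIdeal, mem_nonunits_iff, isUnit_iff_constantCoeff, constantCoeff_X]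
  exact not_isUnit_zero

namespace Ser

/-- The pattern with only nonnegative coordinates. -/
abbrev nonnegPat (m n : ℕ) : Pat m n := fun _ => .nonneg

variable (𝕜 m n) in
/-- The series `1`. -/
def one : Ser 𝕜 (nonnegPat m n) :=
  ⟨Pi.single 0 1, fun d hd => by
    obtain rfl : d = 0 := by
      by_contra h
      exact hd (Pi.single_eq_of_ne h 1)
    exact ⟨zero_mem _, fun s => le_refl (0 : ℤ)⟩, 0, fun d hd => by
    obtain rfl : d = 0 := by
      by_contra h
      exact hd (Pi.single_eq_of_ne h 1)
    exact le_rfl⟩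

lemma val_smul_one (f : DetP 𝕜 m n) {d : Deg m n} (hd : d ∈ dom (nonnegPat m n)) :
    (f • one 𝕜 m n).val d = ∑ᶠ a, if deg m n a = d then coeff a f else 0 := by
  rw [val_smul _ _ hd, conv]
  refine finsum_congr fun a => ?_
  split_ifs with h
  · rw [h, sub_self]
    exact (congrArg _ (Pi.single_eq_same 0 1)).trans (mul_one _)
  · exact mul_eq_zero_of_right _ (Pi.single_eq_of_ne (fun h' => h (sub_eq_zero.mp h').symm) _)

lemma mk_eq_zero {f : DetP 𝕜 m n} (h : f • one 𝕜 m n = 0) :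
    Ideal.Quotient.mk (detI2 𝕜 m n) f = 0 := by
  classical
  have hk := Ideal.iInf_pow_smul_eq_bot_of_isLocalRing (M := DetR 𝕜 m n)
    (IsLocalRing.maximalIdeal (DetP 𝕜 m n)) (Ideal.IsPrime.ne_top inferInstance)
  rw [← Submodule.mem_bot (DetP 𝕜 m n), ← hk, Submodule.mem_iInf]
  intro N
  let B : Finset (Fin m × Fin n →₀ ℕ) := Finset.Iic (Finsupp.equivFunOnFinite.symm fun _ => N)
  let D : Finset (Deg m n) := B.image (deg m n)
  let A : Finset (Fin m × Fin n →₀ ℕ) := D.biUnion fun d =>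
    (Finset.Iic (expBound d)).filter fun a => deg m n a = d
  have hA : ∀ a, a ∈ A ↔ deg m n a ∈ D := by
    intro a
    simp only [A, Finset.mem_biUnion, Finset.mem_filter, Finset.mem_Iic]
    constructor
    · rintro ⟨d, hd, -, rfl⟩
      exact hd
    · exact fun ha => ⟨_, ha, le_expBound le_rfl, rfl⟩
  let f₁ : DetP 𝕜 m n := ∑ a ∈ A, monomial a (coeff a f)
  have h₁ : Ideal.Quotient.mk (detI2 𝕜 m n) f₁ = 0 := by
    have hm : ∀ a, Ideal.Quotient.mk (detI2 𝕜 m n) (monomial a (coeff a f)) =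
        coeff a f • mon 𝕜 a := by
      intro a
      rw [mon, ← Ideal.Quotient.mkₐ_eq_mk 𝕜, ← map_smul, ← map_smul, smul_eq_mul, mul_one]
    rw [map_sum, ← Finset.sum_fiberwise_of_maps_to (g := deg m n) (t := D)
      (fun a ha => (hA a).mp ha)]
    refine Finset.sum_eq_zero fun d hd => ?_
    obtain ⟨a₀, ha₀, rfl⟩ := Finset.mem_image.mp hd
    have h0 : ∑ a ∈ A with deg m n a = deg m n a₀, coeff a f = 0 := by
      have := val_smul_one f (d := deg m n a₀) ⟨deg_mem_balanced a₀, deg_nonneg a₀⟩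
      rw [h, val_zero, finsum_eq_sum_of_support_subset (s := A)] at this
      · rw [Finset.sum_filter]
        exact this.symm
      · intro a ha
        have ha' : deg m n a = deg m n a₀ := by
          by_contra h'
          exact ha (if_neg h')
        rw [Finset.mem_coe, hA, ha']
        exact hd
    rw [Finset.sum_congr rfl (g := fun a => coeff a f • mon 𝕜 a₀) (fun a ha => by
      rw [hm, mon_eq_of_deg_eq a a₀ (Finset.mem_filter.mp ha).2]), ← Finset.sum_smul, h0, zero_smul]
  have h₂ : f - f₁ ∈ IsLocalRing.maximalIdeal (DetP 𝕜 m n) ^ N := by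
    refine mem_maximalIdeal_pow fun a ha => ?_
    have haA : a ∈ A := (hA a).mpr
      (Finset.mem_image_of_mem _ (Finset.mem_Iic.mpr fun p => (ha p).le))
    rw [map_sub, map_sum, Finset.sum_eq_single_of_mem a haA, coeff_monomial_same, sub_self]
    intro b _ hb
    exact coeff_monomial_ne hb.symm _
  have h₃ : Ideal.Quotient.mk (detI2 𝕜 m n) f = (f - f₁) • (1 : DetR 𝕜 m n) := by
    rw [← sub_zero (Ideal.Quotient.mk (detI2 𝕜 m n) f), ← h₁, ← map_sub]
    exact (congrArg (Ideal.Quotient.mk (detI2 𝕜 m n)) (mul_one (f - f₁))).symm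
  rw [h₃]
  exact Submodule.smul_mem_smul h₂ trivial

variable (𝕜 m n) in
/-- The determinantal ring as a module of series. -/
def equivOne : DetR 𝕜 m n ≃ₗ[DetR 𝕜 m n] Ser 𝕜 (nonnegPat m n) :=
  LinearEquiv.ofBijective (LinearMap.toSpanSingleton (DetR 𝕜 m n) _ (one 𝕜 m n)) <| by
    classical
    constructor
    · rw [injective_iff_map_eq_zero]
      intro r hr
      obtain ⟨f, rfl⟩ := Ideal.Quotient.mk_surjective r
      exact mk_eq_zero ((mk_smul f _).symm.trans hr)
    · intro u
      have hc : ∀ d : Deg m n, ∃ a, d ∈ dom (nonnegPat m n) → deg m n a = d := by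
        intro d
        by_cases hd : d ∈ dom (nonnegPat m n)
        · obtain ⟨a, ha⟩ := exists_deg_eq d hd.1 hd.2
          exact ⟨a, fun _ => ha⟩
        · exact ⟨0, fun h => (hd h).elim⟩
      choose c hc using hc
      let f : DetP 𝕜 m n := fun a => if c (deg m n a) = a then u.val (deg m n a) else 0
      have hf : ∀ a, coeff a f = if c (deg m n a) = a then u.val (deg m n a) else 0 :=
        fun a => rfl
      refine ⟨Ideal.Quotient.mk _ f, (mk_smul f _).trans (ext_dom fun d hd => ?_)⟩
      rw [val_smul_one f hd, finsum_eq_single _ (c d), if_pos (hc d hd), hf, hc d hd, if_pos rfl]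
      intro a ha
      split_ifs with h
      · rw [hf, h, if_neg ha.symm]
      · rfl

end Ser

end DetSeries

namespace DetSeries

variable {𝕜 : Type} [Field 𝕜] {m n : ℕ}

open TorsionExt

lemma detx_mem_detJ (i : Fin m) {j : Fin n} (hj : (j : ℕ) < n - 1) :
    detx 𝕜 m n i j ∈ detJ 𝕜 m n := by
  rw [detJ]
  exact Ideal.subset_span ⟨i, j, hj, rfl⟩

lemma Sgn.le.trans {t t' t'' : Sgn} (h : t.le t') (h' : t'.le t'') : t.le t'' := by
  cases t <;> cases t' <;> cases t'' <;> trivial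

section Sequences

variable {τ τ' τ₀ τ₁ τ₂ : Pat m n} {s : Fin m ⊕ Fin n}

variable (𝕜) in
/-- The module of series, as an object of the category of modules. -/
abbrev Ser.obj (τ : Pat m n) : ModuleCat (DetR 𝕜 m n) := ModuleCat.of (DetR 𝕜 m n) (Ser 𝕜 τ)

/-- Restriction of the support, as a morphism. -/
abbrev Ser.resHom (h : ∀ s, (τ s).le (τ' s)) : Ser.obj 𝕜 τ ⟶ Ser.obj 𝕜 τ' :=
  ModuleCat.ofHom (Ser.res h)

lemma Ser.resHom_comp (h : ∀ s, (τ s).le (τ' s)) (h' : ∀ s, (τ' s).le (τ₀ s)) :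
    Ser.resHom (𝕜 := 𝕜) h ≫ Ser.resHom h' = Ser.resHom fun s => (h s).trans (h' s) :=
  ModuleCat.hom_ext (LinearMap.ext (Ser.res_res h h' fun s => (h s).trans (h' s)))

lemma Ser.resHom_comm (h : ∀ s, (τ s).le (τ₀ s)) (h' : ∀ s, (τ₀ s).le (τ' s))
    (k : ∀ s, (τ s).le (τ₁ s)) (k' : ∀ s, (τ₁ s).le (τ' s)) :
    Ser.resHom (𝕜 := 𝕜) h ≫ Ser.resHom h' = Ser.resHom k ≫ Ser.resHom k' := by
  rw [Ser.resHom_comp, Ser.resHom_comp]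

variable (𝕜) in
/-- The short exact sequence attached to a step. -/
abbrev Ser.Step.sc (H : Ser.Step s τ₀ τ₁ τ₂) : ShortComplex (ModuleCat (DetR 𝕜 m n)) :=
  ShortComplex.mk (Ser.resHom (𝕜 := 𝕜) H.le₀₁) (Ser.resHom H.le₁₂)
    (ModuleCat.hom_ext (LinearMap.ext H.res_exact.apply_apply_eq_zero))

lemma Ser.Step.shortExact (H : Ser.Step s τ₀ τ₁ τ₂) : (H.sc 𝕜).ShortExact :=
  ModuleCat.shortComplex_shortExact _ H.res_exact H.res_injective H.res_surjective

lemma subsingleton_of_free {i : Fin m} {j : Fin n} (hj : (j : ℕ) < n - 1)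
    (hi : τ (.inl i) = .free) (hj' : τ (.inr j) = .free) (k : ℕ) :
    Subsingleton (T (detJ 𝕜 m n) k (Ser.obj 𝕜 τ)) :=
  subsingleton_of_bijective_smul _ (detx_mem_detJ i hj) (Ser.bijective_smul hi hj') k

end Sequences

/-- The pattern with negative first `s` rows, nonnegative other rows, and columns given
by `κ`. -/
def rowPat (m : ℕ) (s : ℕ) (κ : Fin n → Sgn) : Pat m n :=
  Sum.elim (fun i => if (i : ℕ) < s then .neg else .nonneg) κ

/-- The pattern with negative first `s` rows, free next row, nonnegative other rows, and columns
given by `κ`. -/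
def rowFree (m : ℕ) (s : ℕ) (κ : Fin n → Sgn) : Pat m n :=
  Sum.elim (fun i => if (i : ℕ) < s then .neg else if (i : ℕ) = s then .free else .nonneg) κ

lemma rowPat_le {s : ℕ} {κ κ' : Fin n → Sgn} (h : ∀ j, (κ j).le (κ' j)) (x : Fin m ⊕ Fin n) :
    (rowPat m s κ x).le (rowPat m s κ' x) := by
  cases x with
  | inl i => exact Sgn.le_refl _
  | inr j => exact h j

lemma rowFree_le {s : ℕ} {κ κ' : Fin n → Sgn} (h : ∀ j, (κ j).le (κ' j)) (x : Fin m ⊕ Fin n) :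
    (rowFree m s κ x).le (rowFree m s κ' x) := by
  cases x with
  | inl i => exact Sgn.le_refl _
  | inr j => exact h j

lemma rowStep {s : ℕ} (hs : s < m) (κ : Fin n → Sgn) :
    Ser.Step (.inl ⟨s, hs⟩) (rowPat m s κ) (rowFree m s κ) (rowPat m (s + 1) κ) where
  fst := if_neg (lt_irrefl s)
  snd := (if_neg (lt_irrefl s)).trans (if_pos rfl)
  thd := if_pos (Nat.lt_succ_self s)
  eq₀₁ := by
    rintro (i | j) h
    · have : (i : ℕ) ≠ s := fun h' => h (congrArg Sum.inl (Fin.ext h'))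
      simp [rowPat, rowFree, this]
    · rfl
  eq₁₂ := by
    rintro (i | j) h
    · have : (i : ℕ) ≠ s := fun h' => h (congrArg Sum.inl (Fin.ext h'))
      have h2 : (i : ℕ) ≤ s ↔ (i : ℕ) < s := by lia
      simp [rowPat, rowFree, this, h2]
    · rfl

/-- The column pattern with a free coordinate among the first `n - 1`. -/
def HasFree (κ : Fin n → Sgn) : Prop := ∃ j : Fin n, (j : ℕ) < n - 1 ∧ κ j = .free

lemma HasFree.subsingleton {κ : Fin n → Sgn} (hκ : HasFree κ) {s : ℕ} (hs : s < m) (k : ℕ) :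
    Subsingleton (T (detJ 𝕜 m n) k (Ser.obj 𝕜 (rowFree m s κ))) := by
  obtain ⟨j, hj, hj'⟩ := hκ
  exact subsingleton_of_free hj (rowStep hs κ).snd hj' k

variable (𝕜) in
/-- Going down the rows shifts the torsion cohomology. -/
lemma exists_rowEquiv {κ κ' : Fin n → Sgn} (hκ : HasFree κ) (hκ' : HasFree κ')
    (h : ∀ j, (κ j).le (κ' j)) (s : ℕ) (hs : s ≤ m) : ∀ i k : ℕ, k = i + s →
    ∃ (e : T (detJ 𝕜 m n) i (Ser.obj 𝕜 (rowPat m s κ)) ≃ₗ[DetR 𝕜 m n]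
        T (detJ 𝕜 m n) k (Ser.obj 𝕜 (rowPat m 0 κ)))
      (e' : T (detJ 𝕜 m n) i (Ser.obj 𝕜 (rowPat m s κ')) ≃ₗ[DetR 𝕜 m n]
        T (detJ 𝕜 m n) k (Ser.obj 𝕜 (rowPat m 0 κ'))),
      ∀ x, e' (map _ i (Ser.resHom (rowPat_le h)) x) =
        map _ k (Ser.resHom (rowPat_le h)) (e x) := by
  induction s with
  | zero =>
    rintro i k rfl
    exact ⟨LinearEquiv.refl _ _, LinearEquiv.refl _ _, fun x => rfl⟩
  | succ s ih =>
    intro i k hk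
    obtain ⟨e, e', he⟩ := ih (by lia) (i + 1) k (by lia)
    have H := rowStep (m := m) hs κ
    have H' := rowStep (m := m) hs κ'
    let d := LinearEquiv.ofBijective (δ (detJ 𝕜 m n) H.shortExact i)
      ⟨δ_injective _ _ i (hκ.subsingleton hs i), δ_surjective _ _ i (hκ.subsingleton hs (i + 1))⟩
    let d' := LinearEquiv.ofBijective (δ (detJ 𝕜 m n) H'.shortExact i)
      ⟨δ_injective _ _ i (hκ'.subsingleton hs i),
        δ_surjective _ _ i (hκ'.subsingleton hs (i + 1))⟩
    let φ : H.sc 𝕜 ⟶ H'.sc 𝕜 := ShortComplex.Hom.mk (Ser.resHom (rowPat_le h))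
      (Ser.resHom (rowFree_le h)) (Ser.resHom (rowPat_le h))
      (Ser.resHom_comm _ _ _ _) (Ser.resHom_comm _ _ _ _)
    refine ⟨d.trans e, d'.trans e', fun x => ?_⟩
    rw [LinearEquiv.trans_apply, LinearEquiv.trans_apply, ← he]
    exact congrArg e' (δ_naturality _ H.shortExact H'.shortExact φ x).symm

/-- The column pattern with negative first `j` columns and nonnegative other columns. -/
def colPat (n j : ℕ) : Fin n → Sgn := fun l => if (l : ℕ) < j then .neg else .nonneg

/-- The column pattern with negative first `j` columns, free next column, and nonnegative other
columns. -/
def colFree (n j : ℕ) : Fin n → Sgn :=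
  fun l => if (l : ℕ) < j then .neg else if (l : ℕ) = j then .free else .nonneg

lemma hasFree_colFree {j : ℕ} (hj : j < n - 1) : HasFree (colFree n j) :=
  ⟨⟨j, by lia⟩, hj, (if_neg (lt_irrefl j)).trans (if_pos rfl)⟩

lemma colFree_le {j j' : ℕ} (h : j ≤ j') (l : Fin n) : (colFree n j l).le (colFree n j' l) := by
  unfold colFree
  split_ifs <;> first | trivial | lia

lemma colStep (m : ℕ) {j : ℕ} (hj : j < n) :
    Ser.Step (.inr ⟨j, hj⟩) (rowPat m 0 (colPat n j)) (rowPat m 0 (colFree n j))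
      (rowPat m 0 (colPat n (j + 1))) where
  fst := if_neg (lt_irrefl j)
  snd := (if_neg (lt_irrefl j)).trans (if_pos rfl)
  thd := if_pos (Nat.lt_succ_self j)
  eq₀₁ := by
    rintro (l | l) h
    · rfl
    · have : (l : ℕ) ≠ j := fun h' => h (congrArg Sum.inr (Fin.ext h'))
      simp [rowPat, colPat, colFree, this]
  eq₁₂ := by
    rintro (l | l) h
    · rfl
    · have : (l : ℕ) ≠ j := fun h' => h (congrArg Sum.inr (Fin.ext h'))
      have h2 : (l : ℕ) ≤ j ↔ (l : ℕ) < j := by lia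
      simp [rowPat, colPat, colFree, this, h2]

lemma isTors_rowPat (κ : Fin n → Sgn) :
    IsTors (detJ 𝕜 m n) (Ser 𝕜 (rowPat m m κ)) :=
  Ser.isTors fun i _ _ => .inl (if_pos i.2)

lemma isTors_colPat : IsTors (detJ 𝕜 m n) (Ser 𝕜 (rowPat m 0 (colPat n (n - 1)))) :=
  Ser.isTors fun _ _ hj => .inr (if_pos hj)

lemma HasFree.subsingleton_of_lt {κ : Fin n → Sgn} (hκ : HasFree κ) {k : ℕ} (hk : m < k) :
    Subsingleton (T (detJ 𝕜 m n) k (Ser.obj 𝕜 (rowPat m 0 κ))) := by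
  obtain ⟨i, rfl⟩ : ∃ i, k = i + 1 + m := ⟨k - 1 - m, by lia⟩
  obtain ⟨e, -⟩ := exists_rowEquiv 𝕜 hκ hκ (fun j => Sgn.le_refl _) m le_rfl (i + 1) _ rfl
  have : Subsingleton (T (detJ 𝕜 m n) (i + 1) (Ser.obj 𝕜 (rowPat m m κ))) :=
    (isTors_rowPat κ).subsingleton i
  exact e.symm.injective.subsingleton

variable (𝕜) in
/-- Going down the columns is injective in large degrees. -/
lemma exists_colMap (j : ℕ) (hj : j ≤ n - 1) : ∀ l k : ℕ, m < l → k = l + j →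
    ∃ D : T (detJ 𝕜 m n) l (Ser.obj 𝕜 (rowPat m 0 (colPat n j))) →ₗ[DetR 𝕜 m n]
      T (detJ 𝕜 m n) k (Ser.obj 𝕜 (rowPat m 0 (colPat n 0))), Function.Injective D := by
  induction j with
  | zero =>
    rintro l k hl rfl
    exact ⟨LinearMap.id, Function.injective_id⟩
  | succ j ih =>
    intro l k hl hk
    obtain ⟨D, hD⟩ := ih (by lia) (l + 1) k (by lia) (by lia)
    have H := colStep m (n := n) (j := j) (by lia)
    exact ⟨D.comp (δ (detJ 𝕜 m n) H.shortExact l), hD.comp (δ_injective _ _ _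
      ((hasFree_colFree (by lia)).subsingleton_of_lt hl))⟩

variable (𝕜) in
/-- The kernel of going down the columns in degree `m` comes from a shorter column pattern. -/
lemma exists_colMap_ker (p : ℕ) (hp : p < n - 1) :
    ∃ D : T (detJ 𝕜 m n) m (Ser.obj 𝕜 (rowPat m 0 (colPat n p))) →ₗ[DetR 𝕜 m n]
      T (detJ 𝕜 m n) (m + p) (Ser.obj 𝕜 (rowPat m 0 (colPat n 0))),
      (∀ y, D y = 0 → y = 0) ∨ ∃ (q : ℕ) (_ : q < p)
        (h : ∀ s, (rowPat m 0 (colFree n q) s).le (rowPat m 0 (colPat n p) s)),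
        ∀ y, D y = 0 → ∃ z, map _ m (Ser.resHom h) z = y := by
  cases p with
  | zero => exact ⟨LinearMap.id, .inl fun y hy => hy⟩
  | succ q =>
    obtain ⟨D, hD⟩ := exists_colMap 𝕜 (m := m) (n := n) q (by lia) (m + 1) (m + (q + 1))
      (by lia) (by lia)
    have H := colStep m (n := n) (j := q) (by lia)
    have hS := H.shortExact (𝕜 := 𝕜)
    refine ⟨D.comp (δ (detJ 𝕜 m n) hS m), .inr ⟨q, Nat.lt_succ_self q, H.le₁₂, fun y hy => ?_⟩⟩
    have h0 : δ (detJ 𝕜 m n) hS m y = 0 := (injective_iff_map_eq_zero D).mp hD _ hy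
    exact exact₃ _ hS y h0

variable (𝕜) in
/-- Series with all rows negative and a free last-but-one column map to the cohomology of the
nonnegative pattern, with controlled kernel. -/
lemma exists_serMap (hm : 2 ≤ m) (hn : 2 ≤ n) :
    ∃ Ψ : Ser 𝕜 (rowPat m m (colFree n (n - 2))) →ₗ[DetR 𝕜 m n]
      T (detJ 𝕜 m n) (m + (n - 2)) (Ser.obj 𝕜 (rowPat m 0 (colPat n 0))),
      ∀ w, Ψ w = 0 → ∀ d : Deg m n, d (.inr ⟨n - 2, by lia⟩) < 0 → w.val d = 0 := by
  have hp : n - 2 < n - 1 := by lia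
  have hp' : n - 2 + 1 = n - 1 := by lia
  obtain ⟨D, hD⟩ := exists_colMap_ker 𝕜 (m := m) (n - 2) hp
  have H := colStep m (n := n) (j := n - 2) (by lia)
  have htors : IsTors (detJ 𝕜 m n) (Ser 𝕜 (rowPat m 0 (colPat n (n - 2 + 1)))) := by
    rw [hp']
    exact isTors_colPat
  have hvan : ∀ i, Subsingleton (T (detJ 𝕜 m n) (i + 1)
      (Ser.obj 𝕜 (rowPat m 0 (colPat n (n - 2 + 1))))) := fun i => IsTors.subsingleton i htors
  obtain ⟨k, rfl⟩ : ∃ k, m = k + 2 := ⟨m - 2, by lia⟩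
  let f := map (detJ 𝕜 (k + 2) n) (k + 2) (Ser.resHom (𝕜 := 𝕜) H.le₀₁)
  have hf : Function.Bijective f := by
    constructor
    · rw [injective_iff_map_eq_zero]
      intro x hx
      obtain ⟨y, rfl⟩ := exact₁ _ (H.shortExact (𝕜 := 𝕜)) x hx
      have := hvan k
      rw [Subsingleton.elim y 0, map_zero]
    · intro x
      have := hvan (k + 1)
      exact exact₂ _ (H.shortExact (𝕜 := 𝕜)) x (Subsingleton.elim _ _)
  let F := LinearEquiv.ofBijective f hf
  let V : ModuleCat (DetR 𝕜 (k + 2) n) := Ser.obj 𝕜 (rowPat (k + 2) (k + 2) (colFree n (n - 2)))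
  let E := LinearEquiv.ofBijective (ev (detJ 𝕜 (k + 2) n) V)
    ⟨ev_injective _ _, IsTors.ev_surjective (M := V) (isTors_rowPat _)⟩
  rcases hD with hD | ⟨q, hq, h, hD⟩
  · obtain ⟨e, -⟩ := exists_rowEquiv 𝕜 (hasFree_colFree hp) (hasFree_colFree hp)
      (fun j => Sgn.le_refl _) (k + 2) le_rfl 0 (k + 2) (by lia)
    refine ⟨D ∘ₗ (E.symm.trans (e.trans F.symm)).toLinearMap, fun w hw d _ => ?_⟩
    have h0 : w = 0 := (E.symm.trans (e.trans F.symm)).map_eq_zero_iff.mp (hD _ hw)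
    rw [h0, Ser.val_zero]
  · have hle := colFree_le (n := n) hq.le
    obtain ⟨e, e', he⟩ := exists_rowEquiv 𝕜 (hasFree_colFree (hq.trans hp)) (hasFree_colFree hp)
      hle (k + 2) le_rfl 0 (k + 2) (by lia)
    refine ⟨D ∘ₗ (E.symm.trans (e'.trans F.symm)).toLinearMap, fun w hw d hd => ?_⟩
    obtain ⟨z, hz⟩ := hD _ hw
    obtain ⟨z, rfl⟩ := e.surjective z
    have hfz : f (map _ (k + 2) (Ser.resHom h) (e z)) = e' (E.symm w) := by
      rw [hz]
      exact F.apply_symm_apply _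
    have hcomp : f (map _ (k + 2) (Ser.resHom h) (e z)) =
        map _ (k + 2) (Ser.resHom (rowPat_le hle)) (e z) := by
      rw [← TorsionExt.map_comp, Ser.resHom_comp]
    rw [hcomp, ← he] at hfz
    have hw' : w = Ser.res (rowPat_le hle) (ev (detJ 𝕜 (k + 2) n) _ z) := by
      have h1 := E.symm_apply_eq.mp (e'.injective hfz).symm
      exact h1.trans (ev_map _ _ _)
    rw [hw']
    refine Ser.res_val_of_mem _ _ fun hd' => not_le_of_gt hd ?_
    have h2 := hd'.2 (.inr ⟨n - 2, by lia⟩)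
    have h3 : rowPat (k + 2) (k + 2) (colFree n q) (.inr ⟨n - 2, by lia⟩) = .nonneg :=
      (if_neg (not_lt_of_gt hq)).trans (if_neg (ne_of_gt hq))
    rw [h3] at h2
    exact h2

variable (𝕜) in
/-- Series with all rows negative and a free last-but-one column map to local cohomology, with
controlled kernel. -/
lemma exists_localMap (hm : 2 ≤ m) (hn : 2 ≤ n) :
    ∃ Ψ : Ser 𝕜 (rowPat m m (colFree n (n - 2))) →ₗ[DetR 𝕜 m n]
      ((localCohomology (detJ 𝕜 m n) (m + n - 2)).obj
        (ModuleCat.of (DetR 𝕜 m n) (DetR 𝕜 m n))),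
      ∀ w, Ψ w = 0 → ∀ d : Deg m n, d (.inr ⟨n - 2, by lia⟩) < 0 → w.val d = 0 := by
  obtain ⟨k, hk⟩ : ∃ k, m + (n - 2) = k + 1 := ⟨m + (n - 2) - 1, by lia⟩
  have hpat : rowPat m 0 (colPat n 0) = Ser.nonnegPat m n := by
    funext s
    cases s <;> simp [rowPat, colPat]
  obtain ⟨Ψ, hΨ⟩ := hpat ▸ hk ▸ exists_serMap 𝕜 hm hn
  rw [show m + n - 2 = k + 1 by lia]
  let a : Ser.obj 𝕜 (Ser.nonnegPat m n) ⟶ ModuleCat.of (DetR 𝕜 m n) (DetR 𝕜 m n) :=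
    ModuleCat.ofHom (Ser.equivOne 𝕜 m n).symm.toLinearMap
  let b : ModuleCat.of (DetR 𝕜 m n) (DetR 𝕜 m n) ⟶ Ser.obj 𝕜 (Ser.nonnegPat m n) :=
    ModuleCat.ofHom (Ser.equivOne 𝕜 m n).toLinearMap
  have hab : a ≫ b = 𝟙 _ :=
    ModuleCat.hom_ext (LinearMap.ext (Ser.equivOne 𝕜 m n).apply_symm_apply)
  have hinj : Function.Injective (map (detJ 𝕜 m n) (k + 1) a) := by
    refine Function.LeftInverse.injective (g := map (detJ 𝕜 m n) (k + 1) b) fun x => ?_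
    rw [← TorsionExt.map_comp, hab, map_id']
  refine ⟨toLocal _ _ k ∘ₗ map (detJ 𝕜 m n) (k + 1) a ∘ₗ Ψ, fun w hw => hΨ w ?_⟩
  exact (injective_iff_map_eq_zero _).mp hinj _
    ((injective_iff_map_eq_zero _).mp (toLocal_injective _ _ _) _ hw)

/-- The series with a single term. -/
def Ser.single {τ : Pat m n} {e : Deg m n} (he : e ∈ dom τ) : Ser 𝕜 τ :=
  ⟨Pi.single e 1, fun d hd => by
    obtain rfl : d = e := by
      by_contra h
      exact hd (Pi.single_eq_of_ne h 1)
    exact he, e, fun d hd => by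
    obtain rfl : d = e := by
      by_contra h
      exact hd (Pi.single_eq_of_ne h 1)
    exact le_rfl⟩

lemma Ser.single_val {τ : Pat m n} {e : Deg m n} (he : e ∈ dom τ) :
    (Ser.single (𝕜 := 𝕜) he).val e = 1 := Pi.single_eq_same e 1

lemma Ser.single_val_of_ne {τ : Pat m n} {e d : Deg m n} (he : e ∈ dom τ) (h : d ≠ e) :
    (Ser.single (𝕜 := 𝕜) he).val d = 0 := Pi.single_eq_of_ne h 1

/-- A term with all row degrees `-1` is killed by the ideal if all rows are negative. -/
lemma Ser.smul_single {τ : Pat m n} (hτ : ∀ i, τ (.inl i) = .neg) {e : Deg m n} (he : e ∈ dom τ)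
    (he' : ∀ i, e (.inl i) = -1) {r : DetR 𝕜 m n} (hr : r ∈ detJ 𝕜 m n) :
    r • Ser.single (𝕜 := 𝕜) he = 0 := by
  have hle : detJ 𝕜 m n ≤
      LinearMap.ker (LinearMap.toSpanSingleton (DetR 𝕜 m n) _ (Ser.single (𝕜 := 𝕜) he)) := by
    rw [detJ, Ideal.span_le]
    rintro _ ⟨i, j, -, rfl⟩
    refine (Ser.mk_smul _ _).trans (Ser.ext_dom fun d hd => ?_)
    rw [← pow_one (X (i, j)), Ser.val_X_pow_smul i j 1 _ hd, Ser.val_zero]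
    refine Ser.single_val_of_ne he fun h => ?_
    have h1 := congrFun h (.inl i)
    have h2 := hd.2 (.inl i)
    rw [hτ] at h2
    have h3 : d (.inl i) < 0 := h2
    simp only [Pi.sub_apply, one_smul, entryDeg_inl, if_pos, he'] at h1
    lia
  exact hle hr

/-- The multidegrees of the terms generating an infinitely generated socle. -/
def socDeg (m n l : ℕ) : Deg m n :=
  Sum.elim (fun _ => -1) fun j => if (j : ℕ) < n - 2 then -1 else
    if (j : ℕ) = n - 2 then -(m + l + 1) else n - 1 + l

lemma socDeg_mem_dom (hn : 2 ≤ n) (l : ℕ) :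
    socDeg m n l ∈ dom (rowPat m m (colFree n (n - 2))) := by
  obtain ⟨p, rfl⟩ : ∃ p, n = p + 2 := ⟨n - 2, by lia⟩
  constructor
  · change ∑ _i : Fin m, (-1 : ℤ) = ∑ j : Fin (p + 2), socDeg m (p + 2) l (.inr j)
    rw [Fin.sum_univ_castSucc, Fin.sum_univ_castSucc]
    simp [socDeg]
    lia
  · rintro (i | j)
    · simp only [rowPat, Sum.elim_inl, if_pos i.2]
      exact neg_one_lt_zero (R := ℤ)
    · by_cases h1 : (j : ℕ) < p
      · simp only [socDeg, rowPat, colFree, Nat.add_sub_cancel, Sum.elim_inr, if_pos h1]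
        exact neg_one_lt_zero (R := ℤ)
      · by_cases h2 : (j : ℕ) = p
        · simp only [rowPat, colFree, Nat.add_sub_cancel, Sum.elim_inr, if_neg h1, if_pos h2]
          trivial
        · simp only [socDeg, rowPat, colFree, Nat.add_sub_cancel, Sum.elim_inr, if_neg h1,
            if_neg h2]
          change (0 : ℤ) ≤ _
          push_cast
          lia

lemma socDeg_inr (hn : 2 ≤ n) (l : ℕ) :
    socDeg m n l (.inr ⟨n - 2, by lia⟩) = -(m + l + 1) :=
  (if_neg (lt_irrefl _)).trans (if_pos rfl)

variable (𝕜) in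
/-- The series supported in degrees at least `N` in a given coordinate. -/
def Ser.truncated (τ : Pat m n) (s : Fin m ⊕ Fin n) (N : ℤ) :
    Submodule (DetR 𝕜 m n) (Ser 𝕜 τ) where
  carrier := {u | ∀ d : Deg m n, d s < N → u.val d = 0}
  zero_mem' := fun d _ => rfl
  add_mem' {u v} hu hv := fun d hd => by rw [Ser.val_add, hu d hd, hv d hd, add_zero]
  smul_mem' r u hu := by
    obtain ⟨f, rfl⟩ := Ideal.Quotient.mk_surjective r
    intro d hd
    rw [Ser.mk_smul]
    by_cases hd' : d ∈ dom τ
    · rw [Ser.val_smul f u hd']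
      refine finsum_eq_zero_of_forall_eq_zero fun a => ?_
      rw [hu _ (lt_of_le_of_lt (sub_le_self _ (deg_nonneg a s)) hd), mul_zero]
    · exact Ser.val_eq_zero _ hd'

end DetSeries

open DetSeries

/-- the `R`-module `Hom_R(R/I, H^{m+n-2}_I(R))` is not finitely generated;
that is, `H^{m+n-2}_I(R)` is not `I`-cofinite, so `I` is not a cofinite ideal. -/
theorem statement10 (hm : 2 ≤ m) (hn : 2 ≤ n) :
    ¬ Module.Finite (DetR 𝕜 m n)
      ((DetR 𝕜 m n ⧸ detJ 𝕜 m n) →ₗ[DetR 𝕜 m n]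
        ((localCohomology (detJ 𝕜 m n) (m + n - 2)).obj
          (ModuleCat.of (DetR 𝕜 m n) (DetR 𝕜 m n)))) := by
  intro hfin
  obtain ⟨Ψ, hΨ⟩ := exists_localMap 𝕜 hm hn
  let w : ℕ → Ser 𝕜 (rowPat m m (colFree n (n - 2))) := fun l =>
    Ser.single (socDeg_mem_dom hn l)
  have hw : ∀ l, ∀ r ∈ detJ 𝕜 m n, r • Ψ (w l) = 0 := fun l r hr => by
    rw [← map_smul, Ser.smul_single (fun i => if_pos i.2) (socDeg_mem_dom hn l)
      (fun _ => rfl) hr, map_zero]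
  let g : ℕ → (DetR 𝕜 m n ⧸ detJ 𝕜 m n) →ₗ[DetR 𝕜 m n]
        ((localCohomology (detJ 𝕜 m n) (m + n - 2)).obj
          (ModuleCat.of (DetR 𝕜 m n) (DetR 𝕜 m n))) := fun l =>
    (detJ 𝕜 m n).liftQ (LinearMap.toSpanSingleton (DetR 𝕜 m n) _ (Ψ (w l))) (hw l)
  have hg : ∀ l, g l (Submodule.Quotient.mk 1) = Ψ (w l) := fun l => one_smul _ (Ψ (w l))
  let F : ℕ →o Submodule (DetR 𝕜 m n) ((DetR 𝕜 m n ⧸ detJ 𝕜 m n) →ₗ[DetR 𝕜 m n]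
        ((localCohomology (detJ 𝕜 m n) (m + n - 2)).obj
          (ModuleCat.of (DetR 𝕜 m n) (DetR 𝕜 m n)))) :=
    ⟨fun N => Submodule.span _ (g '' Set.Iio N), fun N N' h =>
      Submodule.span_mono (Set.image_mono (Set.Iio_subset_Iio h))⟩
  have hnoeth := isNoetherian_of_isNoetherianRing_of_finite (DetR 𝕜 m n)
    ((DetR 𝕜 m n ⧸ detJ 𝕜 m n) →ₗ[DetR 𝕜 m n]
        ((localCohomology (detJ 𝕜 m n) (m + n - 2)).obj
          (ModuleCat.of (DetR 𝕜 m n) (DetR 𝕜 m n))))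
  obtain ⟨N, hN⟩ := monotone_stabilizes_iff_noetherian.mpr hnoeth F
  have hmem : g N ∈ Submodule.span (DetR 𝕜 m n) (g '' Set.Iio N) := by
    have h1 : g N ∈ F (N + 1) := Submodule.subset_span ⟨N, Nat.lt_succ_self N, rfl⟩
    rw [← hN (N + 1) (Nat.le_succ N)] at h1
    exact h1
  let T := Ser.truncated 𝕜 (rowPat m m (colFree n (n - 2))) (.inr ⟨n - 2, by lia⟩) (-(m + N))
  have hT : ∀ h ∈ Submodule.span (DetR 𝕜 m n) (g '' Set.Iio N),
      h (Submodule.Quotient.mk 1) ∈ T.map Ψ := by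
    intro h hh
    induction hh using Submodule.span_induction with
    | mem h hh =>
      obtain ⟨l, hl, rfl⟩ := hh
      rw [hg]
      refine Submodule.mem_map_of_mem fun d hd => Ser.single_val_of_ne _ ?_
      rintro rfl
      rw [socDeg_inr hn] at hd
      have : l < N := hl
      lia
    | zero => exact zero_mem _
    | add h h' _ _ ih ih' => exact add_mem ih ih'
    | smul r h _ ih => exact Submodule.smul_mem _ r ih
  obtain ⟨v, hv, hv'⟩ := hT _ hmem
  have h0 : Ψ (w N - v) = 0 := by rw [map_sub, hv', hg, sub_self]
  have h1 := hΨ _ h0 (socDeg m n N) (by rw [socDeg_inr hn]; lia)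
  have h2 : v.val (socDeg m n N) = 0 := hv _ (by rw [socDeg_inr hn]; lia)
  rw [Ser.val_sub, h2, sub_zero, Ser.single_val] at h1
  exact one_ne_zero h1
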